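/- arXiv:2202.11344 — 3 statements merged into one kernel-verified Lean document; each statement's English description precedes it below -/
import Mathlib

section
/- Let q be a prime power and n ≥ 1 an integer. There is a constant C(n,q) > 0 such that for every integer k > 0, with R = A/t^kA, every function φ : R^n → ℝ, and every λ > 0, the number of primitive vectors w ∈ S^{n−1}(R) with φ*(w) ≥ λ is at most C(n,q) · k^{n+1} · λ^{−n} · ‖φ‖_{ℓ^n}^n. -/
open scoped Classical
noncomputable section

/-- `Rk Fq k` is the quotient ring `R = A/t^k A` where `A = 𝔽_q[[t]]`. -/
abbrev Rk (Fq : Type) [Field Fq] (k : ℕ) : Type :=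
  PowerSeries Fq ⧸ Ideal.span {(PowerSeries.X : PowerSeries Fq) ^ k}

/-- The image of `t` in `R = A/t^k A`. -/
def tbar (Fq : Type) [Field Fq] (k : ℕ) : Rk Fq k :=
  Ideal.Quotient.mk _ PowerSeries.X

/-- The set `S^{n-1}(R) = R^n ∖ (tR)^n` of primitive vectors of `R^n`. -/
def primSet (Fq : Type) [Field Fq] (n k : ℕ) : Set (Fin n → Rk Fq k) :=
  {w | ¬ ∀ i, ∃ r : Rk Fq k, w i = tbar Fq k * r}

/-- The line in `R^n` through `b` in the direction of `w`. -/
def rline {Fq : Type} [Field Fq] {n k : ℕ} (b w : Fin n → Rk Fq k) :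
    Set (Fin n → Rk Fq k) :=
  {v | ∃ r : Rk Fq k, v = fun i => b i + r * w i}

/-- The discrete Kakeya maximal function
`φ*(w) = sup_{ℓ ∥ w} q^{-k} Σ_{v ∈ ℓ} |φ(v)|`. -/
def maxFn (Fq : Type) [Field Fq] [Fintype Fq] {n k : ℕ}
    (φ : (Fin n → Rk Fq k) → ℝ) (w : Fin n → Rk Fq k) : ℝ :=
  ⨆ b : Fin n → Rk Fq k,
    ((Fintype.card Fq : ℝ) ^ k)⁻¹ * ∑ᶠ v ∈ rline b w, |φ v|

section

open Polynomial

theorem exists_carlitz_valuationRing (Fq : Type) [Field Fq] [Fintype Fq] :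
    ∃ (A : Type) (_ : CommRing A) (_ : IsDomain A) (_ : ValuationRing A) (_ : Algebra Fq A)
      (T : A), T ∈ IsLocalRing.maximalIdeal A ∧
        (∀ a : A, ∃ x, x ^ Fintype.card Fq + T * x = a) ∧
        ∃ s : A, s ≠ 0 ∧ s ^ Fintype.card Fq + T * s = 0 := by
  set q := Fintype.card Fq with hq
  have hq1 : 1 < q := Fintype.one_lt_card
  let Ω := AlgebraicClosure (RatFunc Fq)
  let f : Fq[X] →+* Ω := (algebraMap (RatFunc Fq) Ω).comp (algebraMap Fq[X] (RatFunc Fq))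
  have hf : Function.Injective f :=
    (algebraMap (RatFunc Fq) Ω).injective.comp (RatFunc.algebraMap_injective Fq)
  let X' : f.range := ⟨f X, X, rfl⟩
  have hX : Ideal.span {X'} ≠ ⊤ := by
    rw [Ne, Ideal.span_singleton_eq_top]
    intro h
    obtain ⟨⟨y, p, rfl⟩, hy⟩ := h.exists_right_inv
    have h1 : f (X * p) = f 1 := by
      simpa [X', Subtype.ext_iff] using hy
    have h2 := congrArg (Polynomial.coeff · 0) (hf h1)
    simp at h2
  obtain ⟨B, hB, hI⟩ := Ideal.image_subset_nonunits_valuationSubring (K := Ω) _ hX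
  have hmem : ∀ p : Fq[X], f p ∈ B := fun p => hB ⟨p, rfl⟩
  let g : Fq →+* B := (f.codRestrict B.toSubring hmem).comp C
  let T : B := ⟨f X, hmem X⟩
  have hT0 : (T : Ω) ≠ 0 := by
    change f X ≠ 0
    rw [Ne, map_eq_zero_iff f hf]; exact X_ne_zero
  have hroot : ∀ (n : ℕ) (Q : B[X]), Q.degree < n → 0 < n → ∃ y : B, eval y (X ^ n + Q) = 0 := by
    intro n Q hQ hn
    have hm : (X ^ n + Q).Monic := monic_X_pow_add hQ
    have hd : (X ^ n + Q).degree ≠ 0 := by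
      rw [degree_add_eq_left_of_degree_lt (by rwa [degree_X_pow]), degree_X_pow]
      exact_mod_cast hn.ne'
    obtain ⟨x, hx⟩ := IsAlgClosed.exists_aeval_eq_zero (k := Ω) _ hd
    obtain ⟨y, rfl⟩ := IsIntegrallyClosed.isIntegral_iff.1 (⟨_, hm, hx⟩ : IsIntegral B x)
    refine ⟨y, ?_⟩
    rw [aeval_algebraMap_apply] at hx
    apply Subtype.ext
    simpa using hx
  let _ : Algebra Fq B := g.toAlgebra
  refine ⟨B, inferInstance, inferInstance, inferInstance, inferInstance, T, ?_, ?_, ?_⟩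
  · rw [← ValuationSubring.coe_mem_nonunits_iff]
    exact hI ⟨X', Ideal.subset_span rfl, rfl⟩
  · intro a
    obtain ⟨x, hx⟩ := hroot q (C T * X - C a) (by
      refine lt_of_le_of_lt (b := ((1 : ℕ) : WithBot ℕ)) ?_ (by exact_mod_cast hq1)
      compute_degree
      exact le_rfl) (by omega)
    refine ⟨x, ?_⟩
    simp only [eval_add, eval_pow, eval_X, eval_sub, eval_mul, eval_C] at hx
    linear_combination hx
  · obtain ⟨x, hx⟩ := hroot (q - 1) (C T) (by
      refine lt_of_le_of_lt degree_C_le ?_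
      exact_mod_cast (by omega : 0 < q - 1)) (by omega)
    simp only [eval_add, eval_pow, eval_X, eval_C] at hx
    refine ⟨x, ?_, ?_⟩
    · rintro rfl
      rw [zero_pow (by omega), zero_add] at hx
      exact hT0 (by rw [hx]; rfl)
    · obtain ⟨r, hr⟩ : ∃ r, q = r + 1 := ⟨q - 1, by omega⟩
      rw [hr, Nat.add_sub_cancel] at hx
      rw [hr]
      linear_combination x * hx

theorem map_aeval_endomorphism_apply {K M N : Type*} [CommRing K] [AddCommGroup M] [AddCommGroup N]
    [Module K M] [Module K N] (f : Module.End K M) (g : Module.End K N) (φ : M →ₗ[K] N)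
    (h : ∀ m, φ (f m) = g (φ m)) (p : K[X]) (m : M) :
    φ (aeval f p m) = aeval g p (φ m) := by
  have hpow : ∀ i : ℕ, φ ((f ^ i) m) = (g ^ i) (φ m) := by
    intro i
    induction i with
    | zero => simp
    | succ i ih => rw [pow_succ', pow_succ', Module.End.mul_apply, Module.End.mul_apply, h, ih]
  simp only [aeval_endomorphism, Polynomial.sum_def, map_sum, map_smul, hpow]

/-- The quotient map `𝔽_q[t] → R = A/t^k A`. -/
def polyToRk (Fq : Type) [Field Fq] (k : ℕ) : Fq[X] →+* Rk Fq k :=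
  (Ideal.Quotient.mk _).comp coeToPowerSeries.ringHom

theorem polyToRk_eq_zero_iff (Fq : Type) [Field Fq] (k : ℕ) (p : Fq[X]) :
    polyToRk Fq k p = 0 ↔ X ^ k ∣ p := by
  rw [polyToRk, RingHom.comp_apply, Ideal.Quotient.eq_zero_iff_mem, Ideal.mem_span_singleton,
    PowerSeries.X_pow_dvd_iff, X_pow_dvd_iff]
  simp

theorem polyToRk_surjective (Fq : Type) [Field Fq] (k : ℕ) :
    Function.Surjective (polyToRk Fq k) := by
  intro r
  obtain ⟨f, rfl⟩ := Ideal.Quotient.mk_surjective r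
  refine ⟨PowerSeries.trunc k f, ?_⟩
  rw [polyToRk, RingHom.comp_apply, Ideal.Quotient.eq, Ideal.mem_span_singleton,
    PowerSeries.X_pow_dvd_iff]
  intro m hm
  simp [PowerSeries.coeff_trunc, hm]

/-- The Carlitz-type operator `x ↦ x^q + T x`. -/
def carlitzEnd (Fq : Type) [Field Fq] [Fintype Fq] {A : Type} [CommRing A] [Algebra Fq A] (T : A) :
    Module.End Fq A :=
  (FiniteField.frobeniusAlgHom Fq A).toLinearMap + LinearMap.mulLeft Fq T

theorem carlitzEnd_apply (Fq : Type) [Field Fq] [Fintype Fq] {A : Type} [CommRing A]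
    [Algebra Fq A] (T x : A) : carlitzEnd Fq T x = x ^ Fintype.card Fq + T * x := by
  simp [carlitzEnd]

theorem map_carlitzEnd (Fq : Type) [Field Fq] [Fintype Fq] {A B : Type} [CommRing A] [CommRing B]
    [Algebra Fq A] [Algebra Fq B] (f : A →ₐ[Fq] B) (T x : A) :
    f (carlitzEnd Fq T x) = carlitzEnd Fq (f T) (f x) := by
  simp [carlitzEnd_apply]

/-- The additive polynomial `∑ p_j z^{q^j}` attached to `p = ∑ p_j t^j`. -/
def linearizedPoly (Fq : Type) [Field Fq] [Fintype Fq] (κ : Type) [CommRing κ] [Algebra Fq κ] :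
    Fq[X] →ₗ[Fq] κ[X] :=
  (LinearMap.applyₗ (X : κ[X])).comp (aeval (carlitzEnd Fq (0 : κ[X]))).toLinearMap

theorem exists_torsion_embedding (Fq : Type) [Field Fq] [Fintype Fq] (k : ℕ) (hk : 0 < k) :
    ∃ (A : Type) (_ : CommRing A) (_ : IsDomain A) (_ : ValuationRing A) (_ : Algebra Fq A)
      (e : Rk Fq k →+ A) (c : Fq[X] → A[X]), Function.Injective e ∧
        (∀ p r, (c p).eval (e r) = e (polyToRk Fq k p * r)) ∧
        (∀ p, (c p).map (IsLocalRing.residue A) =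
          linearizedPoly Fq (IsLocalRing.ResidueField A) p) ∧
        ∀ r, IsLocalRing.residue A (e r) = 0 := by
  obtain ⟨A, _, _, _, _, T, hT, hsurj, s, hs0, hs⟩ := exists_carlitz_valuationRing Fq
  have hq0 : Fintype.card Fq ≠ 0 := Fintype.card_ne_zero
  set τ := carlitzEnd Fq T with hτ
  have hτsurj : Function.Surjective τ := by
    intro a
    obtain ⟨x, hx⟩ := hsurj a
    exact ⟨x, by rw [hτ, carlitzEnd_apply, hx]⟩
  have hres : ∀ x, IsLocalRing.residue A (τ x) = 0 → IsLocalRing.residue A x = 0 := by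
    intro x hx
    rw [hτ, carlitzEnd_apply, map_add, map_mul, (IsLocalRing.residue_eq_zero_iff T).2 hT, zero_mul,
      add_zero, map_pow] at hx
    exact pow_eq_zero_iff hq0 |>.1 hx
  obtain ⟨ξ, hξ⟩ : ∃ ξ, (τ ^ (k - 1)) ξ = s := by
    have : Function.Surjective (τ ^ (k - 1)) := by
      rw [Module.End.coe_pow]
      exact hτsurj.iterate _
    exact this s
  have hτs : τ s = 0 := by rw [hτ, carlitzEnd_apply, hs]
  have hξk : (τ ^ k) ξ = 0 := by
    obtain ⟨j, rfl⟩ : ∃ j, k = j + 1 := ⟨k - 1, by omega⟩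
    rw [pow_succ', Module.End.mul_apply]
    simpa [← hξ] using hτs
  have hξres : IsLocalRing.residue A ξ = 0 := by
    have : ∀ j x, IsLocalRing.residue A ((τ ^ j) x) = 0 → IsLocalRing.residue A x = 0 := by
      intro j
      induction j with
      | zero => intro x hx; simpa using hx
      | succ j ih =>
        intro x hx
        rw [pow_succ, Module.End.mul_apply] at hx
        exact hres _ (ih _ hx)
    exact this k ξ (by rw [hξk, map_zero])
  let E : Fq[X] →ₗ[Fq] A := (LinearMap.applyₗ ξ).comp (aeval τ).toLinearMap
  have hEmul : ∀ p r, E (p * r) = aeval τ p (E r) := by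
    intro p r
    simp [E]
  have hE0 : ∀ p, E p = 0 ↔ X ^ k ∣ p := by
    intro p
    constructor
    · intro hp
      by_contra hnd
      have hp0 : p ≠ 0 := by rintro rfl; simp at hnd
      obtain ⟨r, hr, hr0⟩ : ∃ r, p = X ^ p.natTrailingDegree * r ∧ r.coeff 0 ≠ 0 := by
        obtain ⟨r, hr⟩ := X_pow_dvd_iff.2 (fun d hd => coeff_eq_zero_of_lt_natTrailingDegree hd :
          ∀ d < p.natTrailingDegree, p.coeff d = 0)
        refine ⟨r, hr, ?_⟩
        have h2 := trailingCoeff_nonzero_iff_nonzero.2 hp0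
        rw [trailingCoeff] at h2
        have h3 : p.coeff p.natTrailingDegree = r.coeff 0 :=
          (congrArg (coeff · p.natTrailingDegree) hr).trans
            (by simpa using coeff_X_pow_mul r p.natTrailingDegree 0)
        rwa [h3] at h2
      set j := p.natTrailingDegree with hj
      have hjk : j < k := by
        by_contra h
        exact hnd ((pow_dvd_pow X (not_lt.1 h)).trans ⟨r, hr⟩)
      have hsr : aeval τ r s = r.coeff 0 • s := by
        obtain ⟨u, hu⟩ : X ∣ r - C (r.coeff 0) := by
          rw [X_dvd_iff]; simp
        rw [sub_eq_iff_eq_add] at hu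
        conv_lhs => rw [hu, mul_comm]
        simp [hτs]
      have h4 : E (X ^ (k - 1 - j) * p) = aeval τ r s := by
        rw [hr, ← mul_assoc, ← pow_add, show k - 1 - j + j = k - 1 by omega, mul_comm, hEmul, ← hξ]
        simp [E]
      rw [hEmul, hp, map_zero, hsr] at h4
      exact (smul_ne_zero hr0 hs0) h4.symm
    · rintro ⟨r, rfl⟩
      rw [mul_comm, hEmul]
      simp [E, hξk]
  have hEeq : ∀ p r, E p = E r ↔ polyToRk Fq k p = polyToRk Fq k r := by
    intro p r
    rw [← sub_eq_zero, ← map_sub, hE0, ← polyToRk_eq_zero_iff, map_sub, sub_eq_zero]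
  have hEres : ∀ p, IsLocalRing.residue A (E p) = 0 := by
    intro p
    have h1 := map_aeval_endomorphism_apply τ (carlitzEnd Fq (0 : IsLocalRing.ResidueField A))
      (IsScalarTower.toAlgHom Fq A (IsLocalRing.ResidueField A)).toLinearMap
      (fun m => by
        have := map_carlitzEnd Fq (IsScalarTower.toAlgHom Fq A (IsLocalRing.ResidueField A)) T m
        have h0 : (IsScalarTower.toAlgHom Fq A (IsLocalRing.ResidueField A)) T = 0 :=
          (IsLocalRing.residue_eq_zero_iff T).2 hT
        rw [h0] at this
        exact this) p ξ
    refine Eq.trans h1 ?_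
    rw [show (IsScalarTower.toAlgHom Fq A (IsLocalRing.ResidueField A)).toLinearMap ξ = 0 from
      hξres, map_zero]
  let g := Function.surjInv (polyToRk_surjective Fq k)
  have hg : ∀ r, polyToRk Fq k (g r) = r := Function.surjInv_eq _
  refine ⟨A, inferInstance, inferInstance, inferInstance, inferInstance,
    AddMonoidHom.mk' (fun r => E (g r)) ?_, fun p => aeval (carlitzEnd Fq (C T)) p X, ?_, ?_, ?_, ?_⟩
  · intro a b
    rw [← map_add, hEeq]
    simp [hg]
  · intro a b hab
    have := (hEeq _ _).1 hab
    rwa [hg, hg] at this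
  · intro p r
    have h1 := map_aeval_endomorphism_apply (carlitzEnd Fq (C T : A[X])) τ
      ((aeval (E (g r)) : A[X] →ₐ[A] A).restrictScalars Fq).toLinearMap
      (fun m => by
        have := map_carlitzEnd Fq ((aeval (E (g r)) : A[X] →ₐ[A] A).restrictScalars Fq) (C T) m
        simpa using this) p X
    have h2 : E (p * g r) = E (g (polyToRk Fq k p * r)) := by
      rw [hEeq]; simp [hg]
    change _ = E (g (polyToRk Fq k p * r))
    rw [← h2, hEmul]
    simpa [Polynomial.coe_aeval_eq_eval] using h1
  · intro p
    have h1 := map_aeval_endomorphism_apply (carlitzEnd Fq (C T : A[X]))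
      (carlitzEnd Fq (0 : (IsLocalRing.ResidueField A)[X]))
      (mapAlgHom (IsScalarTower.toAlgHom Fq A (IsLocalRing.ResidueField A))).toLinearMap
      (fun m => by
        have := map_carlitzEnd Fq
          (mapAlgHom (IsScalarTower.toAlgHom Fq A (IsLocalRing.ResidueField A))) (C T) m
        have h0 : mapAlgHom (IsScalarTower.toAlgHom Fq A (IsLocalRing.ResidueField A)) (C T) = 0 := by
          have : (IsScalarTower.toAlgHom Fq A (IsLocalRing.ResidueField A)) T = 0 :=
            (IsLocalRing.residue_eq_zero_iff T).2 hT
          simpa using this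
        rw [h0] at this
        exact this) p X
    refine Eq.trans ?_ (h1.trans ?_)
    · rfl
    · simp [linearizedPoly]
  · intro r
    exact hEres _

theorem coeff_linearizedPoly (Fq : Type) [Field Fq] [Fintype Fq] (κ : Type) [CommRing κ]
    [Algebra Fq κ] (p : Fq[X]) (j : ℕ) :
    (linearizedPoly Fq κ p).coeff (Fintype.card Fq ^ j) = algebraMap Fq κ (p.coeff j) := by
  have hpow : ∀ i, ((carlitzEnd Fq (0 : κ[X])) ^ i) X = X ^ (Fintype.card Fq ^ i) := by
    intro i
    induction i with
    | zero => simp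
    | succ i ih =>
      rw [pow_succ', Module.End.mul_apply, ih, carlitzEnd_apply, zero_mul, add_zero, ← pow_mul,
        ← pow_succ]
  have h1 : linearizedPoly Fq κ p =
      p.sum fun i b => b • (X : κ[X]) ^ (Fintype.card Fq ^ i) := by
    simp [linearizedPoly, aeval_endomorphism, hpow]
  have h2 : ∀ i, Fintype.card Fq ^ j = Fintype.card Fq ^ i ↔ j = i := fun i =>
    (Nat.pow_right_injective Fintype.one_lt_card).eq_iff
  rw [h1, Polynomial.sum_def, finsetSum_coeff]
  simp only [coeff_smul, coeff_X_pow, h2, smul_ite, smul_zero]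
  rw [Finset.sum_ite_eq]
  split_ifs with h
  · rw [Algebra.smul_def, mul_one]
  · rw [notMem_support_iff.1 h, map_zero]

/-- The polynomial with given digits. -/
def digitPoly {Fq : Type} [Field Fq] {l : ℕ} (a : Fin l → Fq) : Fq[X] :=
  ∑ i, C (a i) * X ^ (i : ℕ)

theorem coeff_digitPoly {Fq : Type} [Field Fq] {l : ℕ} (a : Fin l → Fq) (j : Fin l) :
    (digitPoly a).coeff j = a j := by
  simp only [digitPoly, finsetSum_coeff, coeff_C_mul, coeff_X_pow, Fin.val_inj, mul_ite, mul_one,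
    mul_zero, Finset.sum_ite_eq, Finset.mem_univ, if_true]

theorem digitPoly_sub {Fq : Type} [Field Fq] {l : ℕ} (a b : Fin l → Fq) :
    digitPoly (a - b) = digitPoly a - digitPoly b := by
  simp [digitPoly, sub_mul]

theorem sum_le_of_le_pow_digit (F : Type) [Zero F] [Fintype F] (l : ℕ) :
    ∀ (M : ℕ) (w : (Fin l → F) → ℕ), w 0 = 0 →
      (∀ a (j : Fin l), a j ≠ 0 → w a ≤ M * Fintype.card F ^ (j : ℕ)) →
      ∑ a, w a ≤ M * (l * Fintype.card F ^ l) := by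
  induction l with
  | zero =>
    intro M w h0 _
    have h1 : ∀ a : Fin 0 → F, w a = 0 := fun a => by rw [Subsingleton.elim a 0, h0]
    simp [h1]
  | succ l ih =>
    intro M w h0 h
    rw [← (Fin.consEquiv fun _ => F).sum_comp, Fintype.sum_prod_type]
    change ∑ x : F, ∑ y : Fin l → F, w (Fin.cons x y) ≤ _
    have hz : ∑ y : Fin l → F, w (Fin.cons 0 y) ≤
        M * Fintype.card F * (l * Fintype.card F ^ l) := by
      refine ih _ (fun y => w (Fin.cons 0 y)) ?_ ?_
      · convert h0
        ext i
        refine Fin.cases ?_ (fun i => ?_) i <;> simp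
      · intro y j hy
        refine (h (Fin.cons 0 y) j.succ (by simpa using hy)).trans (le_of_eq ?_)
        simp [pow_succ']; ring
    have hnz : ∀ x : F, x ≠ 0 → ∑ y : Fin l → F, w (Fin.cons x y) ≤ M * Fintype.card F ^ l := by
      intro x hx
      refine (Finset.sum_le_card_nsmul _ _ M fun y _ => ?_).trans (le_of_eq ?_)
      · simpa using h (Fin.cons x y) 0 (by simpa using hx)
      · simp [mul_comm]
    rw [← Finset.add_sum_erase _ _ (Finset.mem_univ (0 : F))]
    have h2 : ∑ x ∈ Finset.univ.erase (0 : F), ∑ y : Fin l → F, w (Fin.cons x y) ≤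
        Fintype.card F * (M * Fintype.card F ^ l) := by
      refine (Finset.sum_le_card_nsmul _ _ _ fun x hx => hnz x (Finset.ne_of_mem_erase hx)).trans ?_
      rw [smul_eq_mul]
      exact Nat.mul_le_mul_right _ (Finset.card_le_univ _)
    refine (add_le_add hz h2).trans (le_of_eq ?_)
    ring

theorem sum_pow_mul_coeff_prod {D I : Type*} [CommRing D] [IsDomain D] [Fintype I]
    [DecidableEq I]
    (s : I → D) (hs : Function.Injective s) (Δ : D)
    (hΔ : ∀ i, ∏ j ∈ Finset.univ.erase i, (s i - s j) = Δ) (α β : ℕ)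
    (hα : α < Fintype.card I) :
    ∑ i, (∏ j ∈ Finset.univ.erase i, (X - C (s j))).coeff β * s i ^ α =
      if α = β then Δ else 0 := by
  have key : ∑ i, C (s i ^ α) * ∏ j ∈ Finset.univ.erase i, (X - C (s j)) = C Δ * X ^ α := by
    rw [← sub_eq_zero]
    refine eq_zero_of_natDegree_lt_card_of_eval_eq_zero _ hs (fun i => ?_) ?_
    · rw [eval_sub, eval_finsetSum, Finset.sum_eq_single i]
      · simp only [eval_mul, eval_prod, eval_sub, eval_X, eval_C, hΔ, eval_pow]
        ring
      · intro j _ hj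
        rw [eval_mul, eval_prod, Finset.prod_eq_zero (i := i), mul_zero]
        · exact Finset.mem_erase.2 ⟨hj.symm, Finset.mem_univ _⟩
        · simp
      · simp
    · refine lt_of_le_of_lt (natDegree_sub_le _ _) (max_lt ?_ ?_)
      · refine lt_of_le_of_lt (natDegree_sum_le_of_forall_le (n := Fintype.card I - 1) _ _
          fun i _ => ?_) (by omega)
        refine (natDegree_C_mul_le _ _).trans ?_
        rw [natDegree_prod_of_monic _ _ fun j _ => monic_X_sub_C _]
        simp [Finset.card_erase_of_mem]
      · exact lt_of_le_of_lt (natDegree_C_mul_X_pow_le _ _) hα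
  have h := congrArg (coeff · β) key
  simp only [finsetSum_coeff, coeff_C_mul, coeff_X_pow] at h
  rw [Finset.sum_congr rfl fun i _ => mul_comm _ _, h, mul_ite, mul_one, mul_zero]
  exact if_congr eq_comm rfl rfl

theorem eq_zero_of_dvd_on_grid (Fq : Type) [Field Fq] [Fintype Fq] (κ : Type) [Field κ]
    [Algebra Fq κ] {m l K : ℕ} (i₀ : Fin (m + 1))
    (hK : (m * l + 1) * Fintype.card Fq ^ l ≤ K)
    (c : (Fin (m + 1) → Fin (Fintype.card Fq ^ l)) → κ)
    (h : ∀ a : Fin m → Fin l → Fq, (X : κ[X]) ^ K ∣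
      ∑ α, C (c α) * ∏ i, (i₀.insertNth X (fun j => linearizedPoly Fq κ (digitPoly (a j))) :
        Fin (m + 1) → κ[X]) i ^ (α i : ℕ)) : c = 0 := by
  set s : (Fin l → Fq) → κ[X] := fun a => linearizedPoly Fq κ (digitPoly a) with hs
  have hsub : ∀ a b, s a - s b = s (a - b) := by
    intro a b
    simp only [hs, digitPoly_sub, map_sub]
  have hcoeff : ∀ a (j : Fin l), (s a).coeff (Fintype.card Fq ^ (j : ℕ)) =
      algebraMap Fq κ (a j) := by
    intro a j
    rw [hs]
    simp only [coeff_linearizedPoly, coeff_digitPoly]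
  have hs0 : s 0 = 0 := by simp [hs, digitPoly]
  have hs_ne : ∀ a, a ≠ 0 → s a ≠ 0 := by
    intro a ha h0
    obtain ⟨j, hj⟩ := Function.ne_iff.1 ha
    have := hcoeff a j
    rw [h0, coeff_zero, eq_comm, map_eq_zero] at this
    exact hj this
  have hinj : Function.Injective s := by
    intro a b hab
    by_contra hne
    exact hs_ne _ (sub_ne_zero.2 hne) (by rw [← hsub, hab, sub_self])
  set Δ : κ[X] := ∏ a ∈ Finset.univ.erase 0, s a with hΔ
  have hΔprod : ∀ i, ∏ j ∈ Finset.univ.erase i, (s i - s j) = Δ := by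
    intro i
    refine Finset.prod_bij' (fun j _ => i - j) (fun j _ => i - j) ?_ ?_ ?_ ?_ ?_
    · intro j hj
      simpa [sub_eq_zero, eq_comm] using hj
    · intro j hj
      simpa using hj
    · simp
    · simp
    · intro j _
      exact hsub _ _
  have hΔ0 : Δ ≠ 0 := Finset.prod_ne_zero_iff.2 fun a ha => hs_ne a (Finset.ne_of_mem_erase ha)
  have hΔdeg : Δ.natTrailingDegree ≤ l * Fintype.card Fq ^ l := by
    have h1 : ∀ S : Finset (Fin l → Fq), (∀ a ∈ S, a ≠ 0) →
        (∏ a ∈ S, s a).natTrailingDegree = ∑ a ∈ S, (s a).natTrailingDegree := by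
      intro S
      induction S using Finset.induction_on with
      | empty => simp
      | insert a S ha ih =>
        intro hS
        rw [Finset.prod_insert ha, Finset.sum_insert ha, natTrailingDegree_mul, ih]
        · exact fun b hb => hS b (Finset.mem_insert_of_mem hb)
        · exact hs_ne a (hS a (Finset.mem_insert_self _ _))
        · exact Finset.prod_ne_zero_iff.2 fun b hb => hs_ne b (hS b (Finset.mem_insert_of_mem hb))
    rw [hΔ, h1 _ fun a ha => Finset.ne_of_mem_erase ha, ← one_mul (l * _)]
    refine (Finset.sum_le_univ_sum_of_nonneg fun _ => Nat.zero_le _).trans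
      (sum_le_of_le_pow_digit Fq l 1 (fun a => (s a).natTrailingDegree) (by simp [hs0]) ?_)
    intro a j haj
    rw [one_mul]
    refine natTrailingDegree_le_of_ne_zero ?_
    rw [hcoeff]
    exact (_root_.map_ne_zero _).2 haj
  have hcard : Fintype.card (Fin l → Fq) = Fintype.card Fq ^ l := by simp
  set u : ℕ → (Fin l → Fq) → κ[X] := fun β i =>
    (∏ j ∈ Finset.univ.erase i, (X - C (s j))).coeff β with hu
  have hdual : ∀ α β : Fin (Fintype.card Fq ^ l), ∑ i, u β i * s i ^ (α : ℕ) =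
      if α = β then Δ else 0 := by
    intro α β
    have := sum_pow_mul_coeff_prod s hinj Δ hΔprod α β (by rw [hcard]; exact α.2)
    simp only [Fin.val_inj] at this
    exact this
  have hG : ∀ β : Fin m → Fin (Fintype.card Fq ^ l),
      ∑ a : Fin m → Fin l → Fq, (∏ j, u (β j) (a j)) *
        (∑ α, C (c α) * ∏ i, (i₀.insertNth X (fun j => s (a j)) :
          Fin (m + 1) → κ[X]) i ^ (α i : ℕ)) =
      Δ ^ m * ∑ x : Fin (Fintype.card Fq ^ l),
        C (c (i₀.insertNth x β : Fin (m + 1) → Fin (Fintype.card Fq ^ l))) * X ^ (x : ℕ) := by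
    intro β
    simp only [Finset.mul_sum]
    rw [Finset.sum_comm, ← (Fin.insertNthEquiv (fun _ => Fin (Fintype.card Fq ^ l)) i₀).sum_comp,
      Fintype.sum_prod_type]
    refine Finset.sum_congr rfl fun x _ => ?_
    have h1 : ∀ γ : Fin m → Fin (Fintype.card Fq ^ l),
        ∑ a : Fin m → Fin l → Fq, (∏ j, u (β j) (a j)) *
          (C (c (i₀.insertNth x γ : Fin (m + 1) → Fin (Fintype.card Fq ^ l))) *
            ∏ i, (i₀.insertNth X (fun j => s (a j)) : Fin (m + 1) → κ[X]) i ^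
            ((i₀.insertNth x γ : Fin (m + 1) → Fin (Fintype.card Fq ^ l)) i : ℕ)) =
        C (c (i₀.insertNth x γ : Fin (m + 1) → Fin (Fintype.card Fq ^ l))) * X ^ (x : ℕ) *
          ∏ j, (if γ j = β j then Δ else 0) := by
      intro γ
      simp only [← hdual, Finset.prod_univ_sum, Fintype.piFinset_univ, Finset.mul_sum]
      refine Finset.sum_congr rfl fun a _ => ?_
      rw [Fin.prod_univ_succAbove _ i₀, Finset.prod_mul_distrib]
      simp only [Fin.insertNth_apply_same, Fin.insertNth_apply_succAbove]
      ring
    refine (Finset.sum_congr rfl fun γ _ => h1 γ).trans ?_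
    rw [Finset.sum_eq_single β]
    · simp; ring
    · intro γ _ hγ
      obtain ⟨j, hj⟩ := Function.ne_iff.1 hγ
      rw [Finset.prod_eq_zero (Finset.mem_univ j) (if_neg hj), mul_zero]
    · simp
  have hGcoeff : ∀ (β : Fin m → Fin (Fintype.card Fq ^ l)) (x : Fin (Fintype.card Fq ^ l)),
      (∑ x : Fin (Fintype.card Fq ^ l),
        C (c (i₀.insertNth x β : Fin (m + 1) → Fin (Fintype.card Fq ^ l))) * X ^ (x : ℕ)).coeff x =
      c (i₀.insertNth x β : Fin (m + 1) → Fin (Fintype.card Fq ^ l)) := by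
    intro β x
    simp [finsetSum_coeff, coeff_X_pow, Fin.val_inj]
  ext α
  by_contra hα
  set β : Fin m → Fin (Fintype.card Fq ^ l) := fun j => α (i₀.succAbove j)
  have hαβ : (i₀.insertNth (α i₀) β : Fin (m + 1) → Fin (Fintype.card Fq ^ l)) = α :=
    Fin.insertNth_self_removeNth i₀ α
  have hx := hGcoeff β (α i₀)
  rw [hαβ] at hx
  have hβ := hG β
  set G := ∑ x : Fin (Fintype.card Fq ^ l),
    C (c (i₀.insertNth x β : Fin (m + 1) → Fin (Fintype.card Fq ^ l))) * X ^ (x : ℕ)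
  have hGne : G.coeff (α i₀) ≠ 0 := by rw [hx]; exact hα
  have hG0 : G ≠ 0 := by rintro h0; simp [h0] at hGne
  have hdvd : X ^ K ∣ Δ ^ m * G := by
    rw [← hβ]
    exact Finset.dvd_sum fun a _ => Dvd.dvd.mul_left (h a) _
  have hne : Δ ^ m * G ≠ 0 := mul_ne_zero (pow_ne_zero _ hΔ0) hG0
  have h1 : K ≤ (Δ ^ m * G).natTrailingDegree :=
    le_natTrailingDegree hne fun d hd => X_pow_dvd_iff.1 hdvd d hd
  have hpow : ∀ r, (Δ ^ r).natTrailingDegree = r * Δ.natTrailingDegree := by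
    intro r
    induction r with
    | zero => simp
    | succ r ih => rw [pow_succ, natTrailingDegree_mul (pow_ne_zero _ hΔ0) hΔ0, ih]; ring
  rw [natTrailingDegree_mul (pow_ne_zero _ hΔ0) hG0, hpow] at h1
  have h2 : G.natTrailingDegree ≤ α i₀ := natTrailingDegree_le_of_ne_zero hGne
  have h3 := Nat.mul_le_mul_left m hΔdeg
  have h4 := (α i₀).2
  nlinarith

/-- The coefficient of `∏ (x_i - v_i)^{β_i}` in the polynomial `∑ c_α x^α`. -/
def taylorCoeff {A ι : Type*} [CommRing A] [Fintype ι] [DecidableEq ι] {N : ℕ}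
    (v : ι → A) (β : ι → ℕ) :
    ((ι → Fin N) → A) →ₗ[A] A :=
  Fintype.linearCombination A fun α => ∏ i, ((α i : ℕ).choose (β i) : A) * v i ^ ((α i : ℕ) - β i)

theorem taylorCoeff_apply {A ι : Type*} [CommRing A] [Fintype ι] [DecidableEq ι] {N : ℕ}
    (v : ι → A) (β : ι → ℕ)
    (c : (ι → Fin N) → A) : taylorCoeff v β c =
      ∑ α, c α * ∏ i, (((α i : ℕ).choose (β i) : A) * v i ^ ((α i : ℕ) - β i)) := by
  simp [taylorCoeff, Fintype.linearCombination_apply]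

theorem sum_eq_sum_taylorCoeff {A ι : Type*} [CommRing A] [Fintype ι] [DecidableEq ι] {N : ℕ}
    (v : ι → A)
    (c : (ι → Fin N) → A) (L : ι → A[X]) :
    ∑ α, C (c α) * ∏ i, L i ^ (α i : ℕ) =
      ∑ β : ι → Fin N, C (taylorCoeff v (fun i => (β i : ℕ)) c) *
        ∏ i, (L i - C (v i)) ^ (β i : ℕ) := by
  have h1 : ∀ (a : Fin N) (i : ι), L i ^ (a : ℕ) = ∑ b : Fin N,
      C (((a : ℕ).choose b : A) * v i ^ ((a : ℕ) - b)) * (L i - C (v i)) ^ (b : ℕ) := by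
    intro a i
    rw [Fin.sum_univ_eq_sum_range (fun b => C (((a : ℕ).choose b : A) * v i ^ ((a : ℕ) - b)) *
      (L i - C (v i)) ^ b) N]
    conv_lhs => rw [← sub_add_cancel (L i) (C (v i)), add_pow]
    refine Finset.sum_subset_zero_on_sdiff (Finset.range_subset_range.2 a.2) ?_ ?_
    · intro b hb
      have : (a : ℕ) < b := by
        have := (Finset.mem_sdiff.1 hb).2
        rw [Finset.mem_range] at this
        omega
      simp [Nat.choose_eq_zero_of_lt this]
    · intro b _
      simp only [map_mul, map_natCast, map_pow]
      ring
  simp only [h1, Finset.prod_univ_sum, Fintype.piFinset_univ, taylorCoeff_apply, map_sum, map_mul,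
    map_prod, Finset.mul_sum, Finset.sum_mul]
  rw [Finset.sum_comm]
  refine Finset.sum_congr rfl fun β _ => Finset.sum_congr rfl fun α _ => ?_
  rw [Finset.prod_mul_distrib, mul_assoc]

theorem X_sub_C_pow_dvd_of_taylorCoeff_eq_zero {A ι : Type*} [CommRing A] [Fintype ι] [DecidableEq ι]
    {N M : ℕ}
    (v : ι → A) (c : (ι → Fin N) → A) (hc : ∀ β : ι → Fin M, taylorCoeff v (fun i => (β i : ℕ)) c = 0)
    (L : ι → A[X]) (x : A) (hx : ∀ i, (L i).eval x = v i) :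
    (X - C x) ^ M ∣ ∑ α, C (c α) * ∏ i, L i ^ (α i : ℕ) := by
  rw [sum_eq_sum_taylorCoeff v]
  refine Finset.dvd_sum fun β _ => ?_
  by_cases h : ∀ i, (β i : ℕ) < M
  · rw [hc fun i => ⟨β i, h i⟩, map_zero, zero_mul]
    exact dvd_zero _
  · push Not at h
    obtain ⟨i, hi⟩ := h
    refine Dvd.dvd.mul_left (Dvd.dvd.trans ?_ (Finset.dvd_prod_of_mem _ (Finset.mem_univ i))) _
    refine (pow_dvd_pow _ hi).trans (pow_dvd_pow_of_dvd ?_ _)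
    rw [← hx i]
    exact X_sub_C_dvd_sub_C_eval

theorem prod_X_sub_C_pow_dvd {A I : Type*} [CommRing A] [IsDomain A] (s : Finset I) (x : I → A)
    (hx : Function.Injective x) (M : I → ℕ) (P : A[X])
    (h : ∀ i ∈ s, (X - C (x i)) ^ M i ∣ P) : ∏ i ∈ s, (X - C (x i)) ^ M i ∣ P := by
  have hinj : Function.Injective (algebraMap A (FractionRing A)) := IsFractionRing.injective _ _
  rw [← map_dvd_map _ hinj (monic_prod_of_monic _ _ fun i _ => (monic_X_sub_C _).pow _),
    Polynomial.map_prod]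
  refine Finset.prod_dvd_of_coprime ?_ fun i hi => Polynomial.map_dvd _ (h i hi)
  intro i _ j _ hij
  simp only [Polynomial.map_pow, Polynomial.map_sub, map_X, map_C]
  refine IsCoprime.pow (isCoprime_X_sub_C_of_isUnit_sub ?_)
  rw [← map_sub]
  exact ((map_ne_zero_iff _ hinj).2 (sub_ne_zero.2 (hx.ne hij))).isUnit

theorem exists_eq_mul_of_valuationRing {A I : Type*} [CommRing A] [IsDomain A] [ValuationRing A]
    [Fintype I] (c : I → A) (hc : c ≠ 0) :
    ∃ (d : A) (c' : I → A) (i : I), d ≠ 0 ∧ (∀ j, c j = d * c' j) ∧ c' i = 1 := by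
  obtain ⟨i₁, hi₁⟩ := Function.ne_iff.1 hc
  have : Nonempty I := ⟨i₁⟩
  have hdir : Directed (fun a b : A => b ∣ a) c := by
    intro i j
    rcases ValuationRing.dvd_total (c i) (c j) with h | h
    · exact ⟨i, dvd_rfl, h⟩
    · exact ⟨j, h, dvd_rfl⟩
  have : IsTrans A (fun a b : A => b ∣ a) := ⟨fun _ _ _ h1 h2 => h2.trans h1⟩
  obtain ⟨i, hi⟩ := hdir.finset_le Finset.univ
  have hi0 : c i ≠ 0 := by
    intro h0
    have := hi i₁ (Finset.mem_univ _)
    rw [h0, zero_dvd_iff] at this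
    exact hi₁ this
  choose c' hc' using fun j => hi j (Finset.mem_univ j)
  exact ⟨c i, c', i, hi0, hc', mul_left_cancel₀ hi0 (by rw [← hc', mul_one])⟩

theorem pow_le_sum_of_lines (Fq : Type) [Field Fq] [Fintype Fq] {k : ℕ} (hk : 0 < k)
    [Fintype (Rk Fq k)] {m l : ℕ} (i₀ : Fin (m + 1))
    (hl : (m * l + 1) * Fintype.card Fq ^ l ≤ Fintype.card Fq ^ k)
    (M : (Fin (m + 1) → Rk Fq k) → ℕ)
    (hM : ∀ y : Fin m → Rk Fq k, ∃ b : Fin (m + 1) → Rk Fq k, Fintype.card Fq ^ k ≤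
      ∑ r, M (fun i => b i + r * (i₀.insertNth 1 y : Fin (m + 1) → Rk Fq k) i)) :
    (Fintype.card Fq ^ l) ^ (m + 1) ≤ ∑ v, M v ^ (m + 1) := by
  by_contra! hlt
  obtain ⟨A, _, _, _, _, e, p, he, hpe, hpres, heres⟩ := exists_torsion_embedding Fq k hk
  set N := Fintype.card Fq ^ l
  obtain ⟨c, hc0, hc⟩ : ∃ c : (Fin (m + 1) → Fin N) → A, c ≠ 0 ∧
      ∀ v, ∀ β : Fin (m + 1) → Fin (M v), taylorCoeff (e ∘ v) (fun i => (β i : ℕ)) c = 0 := by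
    let Λ : ((Fin (m + 1) → Fin N) → A) →ₗ[A] ((Σ v, (Fin (m + 1) → Fin (M v))) → A) :=
      LinearMap.pi fun x => taylorCoeff (e ∘ x.1) (fun i => (x.2 i : ℕ))
    have hΛ : ¬ Function.Injective Λ := by
      intro hinj
      have := card_le_of_injective A Λ hinj
      simp only [Fintype.card_fun, Fintype.card_fin, Fintype.card_sigma] at this
      omega
    rw [injective_iff_map_eq_zero] at hΛ
    push Not at hΛ
    obtain ⟨c, hc, hc0⟩ := hΛ
    exact ⟨c, hc0, fun v β => congrFun hc ⟨v, β⟩⟩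
  obtain ⟨d, c', α₀, hd, hcc', hα₀⟩ := exists_eq_mul_of_valuationRing c hc0
  have hc' : ∀ v, ∀ β : Fin (m + 1) → Fin (M v),
      taylorCoeff (e ∘ v) (fun i => (β i : ℕ)) c' = 0 := by
    intro v β
    have h1 := hc v β
    rw [show c = d • c' from funext hcc', map_smul, smul_eq_mul] at h1
    exact (mul_eq_zero.1 h1).resolve_left hd
  have key := eq_zero_of_dvd_on_grid Fq (IsLocalRing.ResidueField A) i₀ hl
    (fun α => IsLocalRing.residue A (c' α)) ?_
  · have h1 := congrFun key α₀
    simp [hα₀] at h1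
  intro a
  obtain ⟨b, hb⟩ := hM fun j => polyToRk Fq k (digitPoly (a j))
  let L : Fin (m + 1) → A[X] := fun i =>
    C (e (b i)) + p ((i₀.insertNth 1 (fun j => digitPoly (a j)) : Fin (m + 1) → Fq[X]) i)
  have hins : ∀ i, polyToRk Fq k
      ((i₀.insertNth 1 (fun j => digitPoly (a j)) : Fin (m + 1) → Fq[X]) i) =
      (i₀.insertNth 1 (fun j => polyToRk Fq k (digitPoly (a j))) : Fin (m + 1) → Rk Fq k) i := by
    intro i
    refine Fin.succAboveCases i₀ ?_ (fun j => ?_) i <;> simp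
  have hdvd : ∏ r : Rk Fq k, (X - C (e r)) ^ (M (fun i => b i + r * (i₀.insertNth 1
      (fun j => polyToRk Fq k (digitPoly (a j))) : Fin (m + 1) → Rk Fq k) i)) ∣
      ∑ α, C (c' α) * ∏ i, L i ^ (α i : ℕ) := by
    refine prod_X_sub_C_pow_dvd _ _ he _ _ fun r _ => ?_
    refine X_sub_C_pow_dvd_of_taylorCoeff_eq_zero _ _ (hc' _) _ _ fun i => ?_
    simp only [L, eval_add, eval_C, hpe, hins, Function.comp_apply, map_add, mul_comm r]
  have hdvd2 := Polynomial.map_dvd (IsLocalRing.residue A) hdvd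
  rw [Polynomial.map_prod] at hdvd2
  simp only [Polynomial.map_pow, Polynomial.map_sub, map_X, map_C, heres, map_zero, sub_zero,
    Finset.prod_pow_eq_pow_sum, Polynomial.map_sum, Polynomial.map_mul, Polynomial.map_prod] at hdvd2
  refine ((pow_dvd_pow _ hb).trans hdvd2).trans (dvd_of_eq ?_)
  refine Finset.sum_congr rfl fun α _ => ?_
  congr 1
  refine Finset.prod_congr rfl fun i _ => ?_
  congr 1
  simp only [L, Polynomial.map_add, map_C, heres, map_zero, zero_add, hpres]
  refine Fin.succAboveCases i₀ ?_ (fun j => ?_) i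
  · simp [linearizedPoly]
  · simp

theorem polyToRk_digitPoly_bijective (Fq : Type) [Field Fq] (k : ℕ) :
    Function.Bijective fun a : Fin k → Fq => polyToRk Fq k (digitPoly a) := by
  constructor
  · intro a b hab
    have h1 : polyToRk Fq k (digitPoly (a - b)) = 0 := by
      rw [digitPoly_sub, map_sub, sub_eq_zero]
      exact hab
    rw [polyToRk_eq_zero_iff, X_pow_dvd_iff] at h1
    ext i
    have h2 := h1 i i.2
    rw [coeff_digitPoly, Pi.sub_apply, sub_eq_zero] at h2
    exact h2
  · intro r
    obtain ⟨p, rfl⟩ := polyToRk_surjective Fq k r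
    refine ⟨fun i => p.coeff i, ?_⟩
    rw [← sub_eq_zero, ← map_sub, polyToRk_eq_zero_iff, X_pow_dvd_iff]
    intro d hd
    rw [coeff_sub, sub_eq_zero]
    exact coeff_digitPoly (fun i : Fin k => p.coeff i) ⟨d, hd⟩

instance finite_Rk (Fq : Type) [Field Fq] [Finite Fq] (k : ℕ) : Finite (Rk Fq k) :=
  Finite.of_surjective _ (polyToRk_digitPoly_bijective Fq k).2

theorem card_Rk (Fq : Type) [Field Fq] [Fintype Fq] (k : ℕ) [Fintype (Rk Fq k)] :
    Fintype.card (Rk Fq k) = Fintype.card Fq ^ k := by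
  rw [← Fintype.card_of_bijective (polyToRk_digitPoly_bijective Fq k)]
  simp

theorem exists_translates_cover {G : Type*} [AddCommGroup G] [Fintype G] (A : Finset G)
    (U : Finset G) (hU : U.Nonempty) (hA : A.Nonempty) :
    ∃ T : Finset G, (∀ u ∈ U, ∃ a ∈ T, u - a ∈ A) ∧
      (T.card * A.card : ℝ) ≤ Fintype.card G * (Real.log U.card + 1) := by
  induction U using Finset.strongInduction with
  | H U ih =>
  have hG : (0 : ℝ) < Fintype.card G := by exact_mod_cast Fintype.card_pos
  have hUpos : (0 : ℝ) < U.card := by exact_mod_cast hU.card_pos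
  have hApos : (0 : ℝ) < A.card := by exact_mod_cast hA.card_pos
  have hsum : ∑ g : G, (U.filter fun u => u - g ∈ A).card = U.card * A.card := by
    simp only [Finset.card_filter]
    rw [Finset.sum_comm, ← smul_eq_mul, ← Finset.sum_const]
    refine Finset.sum_congr rfl fun u _ => ?_
    rw [← Finset.card_filter]
    refine Finset.card_bij' (fun g _ => u - g) (fun a _ => u - a) ?_ ?_ ?_ ?_ <;> simp
  obtain ⟨g, hg⟩ : ∃ g : G,
      U.card * A.card ≤ Fintype.card G * (U.filter fun u => u - g ∈ A).card := by
    by_contra! h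
    have h1 := Finset.sum_lt_sum_of_nonempty (s := (Finset.univ : Finset G))
      Finset.univ_nonempty fun g _ => h g
    rw [← Finset.mul_sum, hsum, Finset.sum_const, Finset.card_univ, smul_eq_mul] at h1
    exact lt_irrefl _ h1
  set V := U.filter fun u => u - g ∈ A with hV
  have hsplit : V.card + (U \ V).card = U.card := by
    rw [add_comm]
    exact Finset.card_sdiff_add_card_eq_card (Finset.filter_subset _ _)
  have hg' : (U.card * A.card : ℝ) ≤ Fintype.card G * V.card := by exact_mod_cast hg
  have hAG : (A.card : ℝ) ≤ Fintype.card G := by exact_mod_cast Finset.card_le_univ A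
  by_cases hne : (U \ V).Nonempty
  · have hVpos : 0 < V.card := by
      have : (0 : ℝ) < Fintype.card G * V.card := lt_of_lt_of_le (by positivity) hg'
      exact_mod_cast pos_of_mul_pos_right this hG.le
    obtain ⟨v, hv⟩ := Finset.card_pos.1 hVpos
    obtain ⟨T, hT, hTc⟩ := ih (U \ V) (Finset.sdiff_ssubset (Finset.filter_subset _ _) ⟨v, hv⟩) hne
    refine ⟨insert g T, ?_, ?_⟩
    · intro u hu
      by_cases huV : u ∈ V
      · exact ⟨g, Finset.mem_insert_self _ _, (Finset.mem_filter.1 huV).2⟩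
      · obtain ⟨a, ha, h⟩ := hT u (Finset.mem_sdiff.2 ⟨hu, huV⟩)
        exact ⟨a, Finset.mem_insert_of_mem ha, h⟩
    · have hins : ((insert g T).card : ℝ) ≤ T.card + 1 := by
        exact_mod_cast Finset.card_insert_le g T
      have hU'pos : (0 : ℝ) < (U \ V).card := by exact_mod_cast hne.card_pos
      have hlog : Real.log (U \ V).card ≤ Real.log U.card - A.card / Fintype.card G := by
        have h1 : Real.log ((U \ V).card / U.card) ≤ (U \ V).card / U.card - 1 :=
          Real.log_le_sub_one_of_pos (by positivity)
        rw [Real.log_div hU'pos.ne' hUpos.ne'] at h1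
        have h2 : ((U \ V).card / U.card - 1 : ℝ) ≤ - (A.card / Fintype.card G) := by
          have h3 : ((U \ V).card : ℝ) = U.card - V.card := by
            rw [← hsplit]; push_cast; ring
          have h4 : (A.card / Fintype.card G : ℝ) ≤ V.card / U.card := by
            rw [div_le_div_iff₀ hG hUpos]
            linarith
          rw [h3, sub_div, div_self hUpos.ne']
          linarith
        linarith
      calc ((insert g T).card * A.card : ℝ) ≤ (T.card + 1) * A.card := by gcongr
        _ = T.card * A.card + A.card := by ring
        _ ≤ Fintype.card G * (Real.log (U \ V).card + 1) + A.card := by gcongr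
        _ ≤ Fintype.card G * (Real.log U.card - A.card / Fintype.card G + 1) + A.card := by gcongr
        _ = Fintype.card G * (Real.log U.card + 1) := by field_simp; ring
  · refine ⟨{g}, ?_, ?_⟩
    · intro u hu
      refine ⟨g, Finset.mem_singleton_self _, ?_⟩
      by_contra h
      exact hne ⟨u, Finset.mem_sdiff.2 ⟨hu, fun huV => h (Finset.mem_filter.1 huV).2⟩⟩
    · have h0 : 0 ≤ Real.log U.card := Real.log_natCast_nonneg _
      simp only [Finset.card_singleton, Nat.cast_one, one_mul]
      nlinarith

theorem exists_grid_exponent {q : ℕ} (hq : 1 < q) (m : ℕ) {k : ℕ} (hk : 0 < k) :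
    ∃ l, (m * l + 1) * q ^ l ≤ q ^ k ∧ q ^ k ≤ q * q ^ l * ((m + 1) * k) := by
  have hex : ∃ l, q ^ k < q ^ (l + 1) * ((m + 1) * k) := by
    refine ⟨k, ?_⟩
    calc q ^ k < q ^ (k + 1) := Nat.pow_lt_pow_right hq (by omega)
      _ ≤ _ := Nat.le_mul_of_pos_right _ (by positivity)
  refine ⟨Nat.find hex, ?_, ?_⟩
  · rcases hl : Nat.find hex with _ | j
    · simpa using Nat.one_le_pow k q (by omega)
    · have h1 := Nat.find_min hex (m := j) (by omega)
      have h2 : q ^ (j + 1) ≤ q ^ k := by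
        refine le_trans ?_ (not_lt.1 h1)
        exact Nat.le_mul_of_pos_right _ (by positivity)
      have h3 : j + 1 ≤ k := (Nat.pow_le_pow_iff_right hq).1 h2
      refine le_trans ?_ (not_lt.1 h1)
      rw [mul_comm]
      refine Nat.mul_le_mul_left _ ?_
      nlinarith
  · have := (Nat.find_spec hex).le
    rwa [pow_succ'] at this

/-- The shear `v ↦ v - v_{i₀} (0, a)`. -/
def shear {R : Type*} [CommRing R] {m : ℕ} (i₀ : Fin (m + 1)) (a : Fin m → R) :
    (Fin (m + 1) → R) ≃ (Fin (m + 1) → R) where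
  toFun v i := v i - v i₀ * (i₀.insertNth 0 a : Fin (m + 1) → R) i
  invFun v i := v i + v i₀ * (i₀.insertNth 0 a : Fin (m + 1) → R) i
  left_inv v := by ext i; simp
  right_inv v := by ext i; simp

theorem shear_line {R : Type*} [CommRing R] {m : ℕ} (i₀ : Fin (m + 1)) (a y : Fin m → R)
    (b : Fin (m + 1) → R) (r : R) :
    shear i₀ a (fun i => (shear i₀ a).symm b i + r * (i₀.insertNth 1 y : Fin (m + 1) → R) i) =
      fun i => b i + r * (i₀.insertNth 1 (y - a) : Fin (m + 1) → R) i := by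
  ext i
  refine Fin.succAboveCases i₀ ?_ (fun j => ?_) i
  · simp [shear]
  · simp [shear]
    ring

theorem card_directions_le (Fq : Type) [Field Fq] [Fintype Fq] {k : ℕ} (hk : 0 < k)
    [Fintype (Rk Fq k)] {m : ℕ} (i₀ : Fin (m + 1)) (f : (Fin (m + 1) → Rk Fq k) → ℝ)
    (hf : ∀ v, 0 ≤ f v) (lam : ℝ) (hlam : 0 < lam) (Y : Finset (Fin m → Rk Fq k))
    (hY : ∀ y ∈ Y, ∃ b : Fin (m + 1) → Rk Fq k, lam * (Fintype.card Fq : ℝ) ^ k ≤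
      ∑ r, f (fun i => b i + r * (i₀.insertNth 1 y : Fin (m + 1) → Rk Fq k) i)) :
    (Y.card : ℝ) * (Fintype.card Fq : ℝ) ^ k ≤
      (2 * Fintype.card Fq * (m + 1)) ^ (m + 1) * (m * Real.log (Fintype.card Fq) + 1) *
        (k : ℝ) ^ (m + 2) * lam⁻¹ ^ (m + 1) * ∑ v, f v ^ (m + 1) := by
  have hq1 : 1 < Fintype.card Fq := Fintype.one_lt_card
  have hk1 : (1 : ℝ) ≤ k := by exact_mod_cast hk
  have hlogq : 0 ≤ Real.log (Fintype.card Fq) := Real.log_natCast_nonneg _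
  have hsum0 : 0 ≤ ∑ v, f v ^ (m + 1) := Finset.sum_nonneg fun v _ => pow_nonneg (hf v) _
  rcases Y.eq_empty_or_nonempty with rfl | hYne
  · simp only [Finset.card_empty, Nat.cast_zero, zero_mul]
    positivity
  obtain ⟨T, hT, hTc⟩ := exists_translates_cover Y Finset.univ Finset.univ_nonempty hYne
  obtain ⟨l, hl1, hl2⟩ := exists_grid_exponent hq1 m hk
  set μ : (Fin (m + 1) → Rk Fq k) → ℕ := fun v => ⌊2 * f v / lam⌋₊ with hμ
  set M : (Fin (m + 1) → Rk Fq k) → ℕ := fun v => T.sup fun a => μ (shear i₀ a v) with hM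
  have hlow : (Fintype.card Fq ^ l) ^ (m + 1) ≤ ∑ v, M v ^ (m + 1) := by
    refine pow_le_sum_of_lines Fq hk i₀ hl1 M fun y => ?_
    obtain ⟨a, ha, hya⟩ := hT y (Finset.mem_univ _)
    obtain ⟨b, hb⟩ := hY _ hya
    refine ⟨(shear i₀ a).symm b, ?_⟩
    have h1 : ∑ r, μ (fun i => b i + r * (i₀.insertNth 1 (y - a) : Fin (m + 1) → Rk Fq k) i) ≤
        ∑ r, M (fun i => (shear i₀ a).symm b i +
          r * (i₀.insertNth 1 y : Fin (m + 1) → Rk Fq k) i) := by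
      refine Finset.sum_le_sum fun r _ => ?_
      rw [← shear_line]
      exact Finset.le_sup (f := fun a => μ (shear i₀ a _)) ha
    refine le_trans ?_ h1
    have h2 : ∑ r : Rk Fq k,
        (2 * f (fun i => b i + r * (i₀.insertNth 1 (y - a) : Fin (m + 1) → Rk Fq k) i) / lam - 1) ≤
        ∑ r, (μ (fun i => b i + r * (i₀.insertNth 1 (y - a) : Fin (m + 1) → Rk Fq k) i) : ℝ) :=
      Finset.sum_le_sum fun r _ => (Nat.sub_one_lt_floor _).le
    rw [Finset.sum_sub_distrib, ← Finset.sum_div, ← Finset.mul_sum, Finset.sum_const,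
      Finset.card_univ, card_Rk, nsmul_eq_mul, mul_one, Nat.cast_pow] at h2
    have h3 : 2 * (Fintype.card Fq : ℝ) ^ k ≤ 2 * (∑ r : Rk Fq k,
        f (fun i => b i + r * (i₀.insertNth 1 (y - a) : Fin (m + 1) → Rk Fq k) i)) / lam := by
      rw [le_div_iff₀ hlam]
      linarith
    have h4 : ((Fintype.card Fq ^ k : ℕ) : ℝ) ≤ ((∑ r, μ (fun i => b i + r *
        (i₀.insertNth 1 (y - a) : Fin (m + 1) → Rk Fq k) i) : ℕ) : ℝ) := by
      push_cast
      linarith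
    exact_mod_cast h4
  have hup : ∑ v, M v ^ (m + 1) ≤ T.card * ∑ v, μ v ^ (m + 1) := by
    have h1 : ∀ v, M v ^ (m + 1) ≤ ∑ a ∈ T, μ (shear i₀ a v) ^ (m + 1) := by
      intro v
      refine Finset.sup_induction (p := fun x : ℕ => x ^ (m + 1) ≤ _) ?_ ?_ ?_
      · simp
      · intro x hx y hy
        rcases max_choice x y with h | h
        · exact le_of_eq_of_le (congrArg (· ^ (m + 1)) h) hx
        · exact le_of_eq_of_le (congrArg (· ^ (m + 1)) h) hy
      · intro a ha
        exact Finset.single_le_sum (f := fun a => μ (shear i₀ a v) ^ (m + 1))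
          (fun _ _ => Nat.zero_le _) ha
    refine (Finset.sum_le_sum fun v _ => h1 v).trans (le_of_eq ?_)
    rw [Finset.sum_comm, ← smul_eq_mul, ← Finset.sum_const]
    exact Finset.sum_congr rfl fun a _ => (shear i₀ a).sum_comp fun v => μ v ^ (m + 1)
  have hμf : (∑ v, μ v ^ (m + 1) : ℝ) ≤ (2 * lam⁻¹) ^ (m + 1) * ∑ v, f v ^ (m + 1) := by
    rw [Finset.mul_sum]
    refine Finset.sum_le_sum fun v _ => ?_
    rw [← mul_pow]
    refine pow_le_pow_left₀ (Nat.cast_nonneg _) ?_ _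
    refine (Nat.floor_le (div_nonneg (mul_nonneg zero_le_two (hf v)) hlam.le)).trans (le_of_eq ?_)
    ring
  have hlow' : ((Fintype.card Fq : ℝ) ^ l) ^ (m + 1) ≤ T.card * (∑ v, (μ v : ℝ) ^ (m + 1)) := by
    exact_mod_cast hlow.trans hup
  have hl2' : (Fintype.card Fq : ℝ) ^ k ≤ Fintype.card Fq * (Fintype.card Fq : ℝ) ^ l * ((m + 1) * k) := by
    exact_mod_cast hl2
  set q : ℝ := ((Fintype.card Fq : ℕ) : ℝ) with hq
  have hq0 : 0 < q := by rw [hq]; exact_mod_cast (by omega : 0 < Fintype.card Fq)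
  have hcardG : (Fintype.card (Fin m → Rk Fq k) : ℝ) = (q ^ k) ^ m := by
    rw [Fintype.card_fun, card_Rk, Fintype.card_fin]
    push_cast
    rfl
  rw [Finset.card_univ, hcardG, ← pow_mul, Real.log_pow, pow_mul] at hTc
  have hlog : ((k * m : ℕ) : ℝ) * Real.log q + 1 ≤ k * (m * Real.log q + 1) := by
    push_cast
    nlinarith
  have hmain : (Y.card * q ^ k) * (q ^ k) ^ m ≤
      ((2 * q * (m + 1)) ^ (m + 1) * (m * Real.log q + 1) *
        (k : ℝ) ^ (m + 2) * lam⁻¹ ^ (m + 1) * ∑ v, f v ^ (m + 1)) * (q ^ k) ^ m := by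
    calc (Y.card * q ^ k) * (q ^ k) ^ m = Y.card * (q ^ k) ^ (m + 1) := by ring
      _ ≤ Y.card * (q * q ^ l * ((m + 1) * k)) ^ (m + 1) := by gcongr
      _ = Y.card * (q * (m + 1) * k) ^ (m + 1) * (q ^ l) ^ (m + 1) := by
        simp only [mul_pow]; ring
      _ ≤ Y.card * (q * (m + 1) * k) ^ (m + 1) *
          (T.card * ((2 * lam⁻¹) ^ (m + 1) * ∑ v, f v ^ (m + 1))) := by
        gcongr
        exact hlow'.trans (mul_le_mul_of_nonneg_left hμf (Nat.cast_nonneg _))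
      _ = (T.card * Y.card) * ((q * (m + 1) * k) ^ (m + 1) *
          ((2 * lam⁻¹) ^ (m + 1) * ∑ v, f v ^ (m + 1))) := by ring
      _ ≤ ((q ^ k) ^ m * (k * (m * Real.log q + 1))) * ((q * (m + 1) * k) ^ (m + 1) *
          ((2 * lam⁻¹) ^ (m + 1) * ∑ v, f v ^ (m + 1))) := by
        refine mul_le_mul_of_nonneg_right
          (hTc.trans (mul_le_mul_of_nonneg_left hlog (by positivity)))
          (mul_nonneg (by positivity) (mul_nonneg (by positivity) hsum0))
      _ = _ := by simp only [mul_pow]; ring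
  exact le_of_mul_le_mul_right hmain (by positivity)

theorem exists_isUnit_of_mem_primSet {Fq : Type} [Field Fq] {n k : ℕ} {w : Fin n → Rk Fq k}
    (hw : w ∈ primSet Fq n k) : ∃ i, IsUnit (w i) := by
  simp only [primSet, Set.mem_ofPred_eq, not_forall] at hw
  obtain ⟨i, hi⟩ := hw
  refine ⟨i, ?_⟩
  obtain ⟨g, hg⟩ := Ideal.Quotient.mk_surjective (w i)
  rw [← hg] at hi ⊢
  refine IsUnit.map _ (PowerSeries.isUnit_iff_constantCoeff.2 (isUnit_iff_ne_zero.2 fun h0 => hi ?_))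
  obtain ⟨r, rfl⟩ := PowerSeries.X_dvd_iff.2 h0
  exact ⟨Ideal.Quotient.mk _ r, by rw [tbar, map_mul]⟩

theorem exists_sum_line_of_le_maxFn {Fq : Type} [Field Fq] [Fintype Fq] {m k : ℕ}
    [Fintype (Rk Fq k)] (φ : (Fin (m + 1) → Rk Fq k) → ℝ) (i₀ : Fin (m + 1)) (u : (Rk Fq k)ˣ)
    (y : Fin m → Rk Fq k) (lam : ℝ)
    (h : lam ≤ maxFn Fq φ fun i => u * (i₀.insertNth 1 y : Fin (m + 1) → Rk Fq k) i) :
    ∃ b : Fin (m + 1) → Rk Fq k, lam * (Fintype.card Fq : ℝ) ^ k ≤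
      ∑ r, |φ (fun i => b i + r * (i₀.insertNth 1 y : Fin (m + 1) → Rk Fq k) i)| := by
  obtain ⟨b, hb⟩ := exists_eq_ciSup_of_finite (f := fun b : Fin (m + 1) → Rk Fq k =>
    ((Fintype.card Fq : ℝ) ^ k)⁻¹ * ∑ᶠ v ∈ rline b
      (fun i => u * (i₀.insertNth 1 y : Fin (m + 1) → Rk Fq k) i), |φ v|)
  refine ⟨b, ?_⟩
  have hline : rline b (fun i => u * (i₀.insertNth 1 y : Fin (m + 1) → Rk Fq k) i) =
      Set.range fun r : Rk Fq k => fun i =>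
        b i + r * (i₀.insertNth 1 y : Fin (m + 1) → Rk Fq k) i := by
    ext v
    constructor
    · rintro ⟨r, rfl⟩
      exact ⟨r * u, by ext i; simp only; ring⟩
    · rintro ⟨r, rfl⟩
      refine ⟨r * (u⁻¹ : (Rk Fq k)ˣ), ?_⟩
      ext i
      rw [mul_assoc, Units.inv_mul_cancel_left]
  have hinj : Function.Injective fun r : Rk Fq k => fun i =>
        b i + r * (i₀.insertNth 1 y : Fin (m + 1) → Rk Fq k) i := by
    intro r r' hr
    simpa using congrFun hr i₀
  have h1 : maxFn Fq φ (fun i => u * (i₀.insertNth 1 y : Fin (m + 1) → Rk Fq k) i) = _ := hb.symm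
  rw [h1] at h
  simp only [hline] at h
  rw [finsum_mem_range hinj, finsum_eq_sum_of_fintype] at h
  have hq : (0 : ℝ) < (Fintype.card Fq : ℝ) ^ k := by
    have : 0 < Fintype.card Fq := Fintype.card_pos
    positivity
  rwa [le_inv_mul_iff₀ hq, mul_comm] at h

end

/-- **Kakeya distributional estimate.**  There is a constant `C(n,q) > 0` such
that for every `k > 0`, every `φ : R^n → ℝ` and every `λ > 0`, the number of
primitive vectors `w ∈ S^{n-1}(R)` with `φ*(w) ≥ λ` is at most
`C(n,q)·k^{n+1}·λ^{-n}·‖φ‖_{ℓ^n}^n`. -/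
theorem kakeya_distributional_estimate
    (Fq : Type) [Field Fq] [Fintype Fq] (n : ℕ) (hn : 1 ≤ n) :
    ∃ C : ℝ, 0 < C ∧
      ∀ k : ℕ, 0 < k → ∀ φ : (Fin n → Rk Fq k) → ℝ, ∀ lam : ℝ, 0 < lam →
        ({w ∈ primSet Fq n k | lam ≤ maxFn Fq φ w}.ncard : ℝ)
          ≤ C * (k : ℝ) ^ (n + 1) * lam⁻¹ ^ n * ∑ᶠ v, |φ v| ^ n := by
  obtain ⟨m, rfl⟩ : ∃ m, n = m + 1 := ⟨n - 1, by omega⟩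
  have hq0 : 0 < Fintype.card Fq := Fintype.card_pos
  have hlogq : 0 ≤ Real.log (Fintype.card Fq) := Real.log_natCast_nonneg _
  refine ⟨(m + 1) * ((2 * Fintype.card Fq * (m + 1)) ^ (m + 1) *
    (m * Real.log (Fintype.card Fq) + 1)), by positivity, ?_⟩
  intro k hk φ lam hlam
  have : Fintype (Rk Fq k) := Fintype.ofFinite _
  let Y : Fin (m + 1) → Finset (Fin m → Rk Fq k) := fun i₀ => Finset.univ.filter fun y =>
    ∃ b : Fin (m + 1) → Rk Fq k, lam * (Fintype.card Fq : ℝ) ^ k ≤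
      ∑ r, |φ (fun i => b i + r * (i₀.insertNth 1 y : Fin (m + 1) → Rk Fq k) i)|
  let W : Finset (Fin (m + 1) → Rk Fq k) := Finset.univ.biUnion fun i₀ =>
    (Y i₀ ×ˢ Finset.univ).image fun x : (Fin m → Rk Fq k) × Rk Fq k =>
      fun i => x.2 * (i₀.insertNth 1 x.1 : Fin (m + 1) → Rk Fq k) i
  have hsub : {w ∈ primSet Fq (m + 1) k | lam ≤ maxFn Fq φ w} ⊆ (W : Set _) := by
    rintro w ⟨hw, hmax⟩
    obtain ⟨i₀, u, hu⟩ := exists_isUnit_of_mem_primSet hw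
    have hwy : (fun i => (u : Rk Fq k) * (i₀.insertNth 1
        (fun j => (u⁻¹ : (Rk Fq k)ˣ) * w (i₀.succAbove j)) : Fin (m + 1) → Rk Fq k) i) = w := by
      ext i
      refine Fin.succAboveCases i₀ ?_ (fun j => ?_) i <;> simp [← hu]
    simp only [W, Finset.coe_biUnion, Set.mem_iUnion, Finset.mem_coe, Finset.mem_image,
      Finset.mem_product, Finset.mem_univ, and_true]
    refine ⟨i₀, trivial, (_, u), ?_, hwy⟩
    rw [← hwy] at hmax
    exact Finset.mem_filter.2
      ⟨Finset.mem_univ _, exists_sum_line_of_le_maxFn φ i₀ u _ lam hmax⟩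
  have hcard : ({w ∈ primSet Fq (m + 1) k | lam ≤ maxFn Fq φ w}.ncard : ℝ) ≤
      ∑ i₀, (Y i₀).card * (Fintype.card Fq : ℝ) ^ k := by
    have h1 := Set.ncard_le_ncard hsub W.finite_toSet
    rw [Set.ncard_coe_finset] at h1
    have h2 : W.card ≤ ∑ i₀, (Y i₀).card * Fintype.card Fq ^ k := by
      refine Finset.card_biUnion_le.trans (Finset.sum_le_sum fun i₀ _ => ?_)
      refine Finset.card_image_le.trans (le_of_eq ?_)
      rw [Finset.card_product, Finset.card_univ, card_Rk]
    exact_mod_cast h1.trans h2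
  rw [finsum_eq_sum_of_fintype]
  refine hcard.trans ((Finset.sum_le_sum fun i₀ _ => card_directions_le Fq hk i₀ (fun v => |φ v|)
    (fun v => abs_nonneg _) lam hlam (Y i₀) fun y hy => (Finset.mem_filter.1 hy).2).trans
      (le_of_eq ?_))
  rw [Finset.sum_const, Finset.card_univ, Fintype.card_fin, nsmul_eq_mul]
  push_cast
  ring
end
end

section
/- Let f ∈ B[z_1,…,z_n] be a nonzero polynomial whose leading term with respect to the lexicographical ordering on monomials is c_α z^α = c_α z_1^{α_1}⋯z_n^{α_n}, where α_j < q^k for all j and c_α ∈ B is nonzero. Then for all 0 < θ ≤ 1, the number of tuples y ∈ C^n such that v_X(f(y)) ≥ v_X(c_α) + θnq^k (where the condition is also counted as satisfied if f(y) = 0) is strictly less than max{q^{nk}, |α|·k·q^{k(n−1)+1}/θ}, where |α| = α_1 + ⋯ + α_n. -/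
open scoped Classical
noncomputable section

/-- For `a = a_0 + a_1 t + ⋯ + a_{k-1} t^{k-1}`, the associated polynomial
`s_a = Σ_{j<k} a_j X^{q^j} ∈ 𝔽_q[X]`. -/
def sMap (Fq : Type) [Field Fq] [Fintype Fq] (k : ℕ) (a : Polynomial Fq) :
    Polynomial Fq :=
  ∑ j ∈ Finset.range k, Polynomial.C (a.coeff j) * Polynomial.X ^ (Fintype.card Fq ^ j)

open Polynomial in
theorem Polynomial.leadingCoeff_mul_prod_sub_eq_sum {R ι : Type*} [CommRing R] [IsDomain R]
    [DecidableEq ι] (p : R[X]) (hp : p ≠ 0) (s : Finset ι) (v : ι → R) (hv : Set.InjOn v s)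
    (hs : s.card = p.natDegree + 1) :
    p.leadingCoeff * ∏ i ∈ s, ∏ j ∈ s.erase i, (v i - v j) =
      ∑ i ∈ s, p.eval (v i) * ∏ l ∈ s.erase i, ∏ j ∈ s.erase l, (v l - v j) := by
  set Y : ι → R := fun i => ∏ j ∈ s.erase i, (v i - v j) with hY
  let φ := algebraMap R (FractionRing R)
  have hφ : Function.Injective φ := IsFractionRing.injective R (FractionRing R)
  have hY0 : ∀ i ∈ s, φ (Y i) ≠ 0 := by
    intro i hi
    rw [map_ne_zero_iff φ hφ, hY, Finset.prod_ne_zero_iff]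
    intro j hj
    rw [Finset.mem_erase] at hj
    exact sub_ne_zero.2 fun h => hj.1 (hv hi hj.2 h).symm
  have hdeg : (s.card : WithBot ℕ) = (p.map φ).degree + 1 := by
    rw [degree_map_eq_of_injective hφ, degree_eq_natDegree hp, hs]
    norm_cast
  have h := Lagrange.leadingCoeff_eq_sum (v := φ ∘ v) (hφ.comp_injOn hv) hdeg
  rw [leadingCoeff_map_of_injective hφ] at h
  apply hφ
  rw [map_mul, h, map_prod, map_sum, Finset.sum_mul]
  refine Finset.sum_congr rfl fun i hi => ?_
  have hden : ∏ j ∈ s.erase i, ((φ ∘ v) i - (φ ∘ v) j) = φ (Y i) := by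
    simp [hY, map_prod]
  rw [hden, ← Finset.mul_prod_erase s (fun i => φ (Y i)) hi, map_mul,
    map_prod φ Y, Function.comp_apply, eval_map_apply]
  rw [div_mul_eq_mul_div, div_eq_iff (hY0 i hi)]
  ring

open Polynomial in
theorem Polynomial.natTrailingDegree_prod_of_ne_zero {R ι : Type*} [CommRing R] [IsDomain R]
    (s : Finset ι) (f : ι → R[X]) (hf : ∀ i ∈ s, f i ≠ 0) :
    (∏ i ∈ s, f i).natTrailingDegree = ∑ i ∈ s, (f i).natTrailingDegree := by
  induction s using Finset.induction_on with
  | empty => simp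
  | insert a s ha ih =>
    rw [Finset.prod_insert ha, Finset.sum_insert ha, natTrailingDegree_mul
      (hf a (Finset.mem_insert_self a s))
      (Finset.prod_ne_zero_iff.2 fun i hi => hf i (Finset.mem_insert_of_mem hi)),
      ih fun i hi => hf i (Finset.mem_insert_of_mem hi)]

open Polynomial in
/-- If `p` has degree `d`, then at one of any `d + 1` distinct points the `X`-adic valuation of its
value exceeds that of the leading coefficient by no more than a bound for the products of
differences of the points. -/
theorem Polynomial.exists_eval_natTrailingDegree_le {R ι : Type*} [CommRing R] [IsDomain R]
    [DecidableEq ι] (p : R[X][X]) (hp : p ≠ 0) (s : Finset ι) (v : ι → R[X]) (hv : Set.InjOn v s)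
    (hs : s.card = p.natDegree + 1) (M : ℕ)
    (hM : ∀ i ∈ s, ∑ j ∈ s.erase i, (v i - v j).natTrailingDegree ≤ M) :
    ∃ i ∈ s, p.eval (v i) ≠ 0 ∧
      (p.eval (v i)).natTrailingDegree ≤ p.leadingCoeff.natTrailingDegree + M := by
  by_contra! hcon
  have key := p.leadingCoeff_mul_prod_sub_eq_sum hp s v hv hs
  set Y : ι → R[X] := fun i => ∏ j ∈ s.erase i, (v i - v j) with hY
  have hsub : ∀ i ∈ s, ∀ j ∈ s.erase i, v i - v j ≠ 0 := by
    intro i hi j hj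
    rw [Finset.mem_erase] at hj
    exact sub_ne_zero.2 fun h => hj.1 (hv hi hj.2 h).symm
  have hY0 : ∀ i ∈ s, Y i ≠ 0 := fun i hi => Finset.prod_ne_zero_iff.2 (hsub i hi)
  have hYM : ∀ i ∈ s, (Y i).natTrailingDegree ≤ M := fun i hi => by
    rw [natTrailingDegree_prod_of_ne_zero _ _ (hsub i hi)]
    exact hM i hi
  have hlc : p.leadingCoeff ≠ 0 := leadingCoeff_ne_zero.2 hp
  have hprod : ∏ i ∈ s, Y i ≠ 0 := Finset.prod_ne_zero_iff.2 hY0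
  have hdvd : (X : R[X]) ^ (p.leadingCoeff.natTrailingDegree +
      ∑ i ∈ s, (Y i).natTrailingDegree + 1) ∣ p.leadingCoeff * ∏ i ∈ s, Y i := by
    rw [key]
    refine Finset.dvd_sum fun i hi => ?_
    have hsum := Finset.add_sum_erase s (fun i => (Y i).natTrailingDegree) hi
    have hYi := hYM i hi
    have hprod' : ∏ l ∈ s.erase i, Y l ≠ 0 :=
      Finset.prod_ne_zero_iff.2 fun l hl => hY0 l (Finset.mem_of_mem_erase hl)
    rcases eq_or_ne (p.eval (v i)) 0 with h0 | h0
    · simp [h0]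
    have hlt := hcon i hi h0
    rw [X_pow_dvd_iff]
    intro d hd
    apply coeff_eq_zero_of_lt_natTrailingDegree
    rw [natTrailingDegree_mul h0 hprod', natTrailingDegree_prod_of_ne_zero _ _
      fun l hl => hY0 l (Finset.mem_of_mem_erase hl)]
    omega
  have hcoeff := X_pow_dvd_iff.1 hdvd (p.leadingCoeff * ∏ i ∈ s, Y i).natTrailingDegree (by
    rw [natTrailingDegree_mul hlc hprod, natTrailingDegree_prod_of_ne_zero _ _ hY0]
    exact Nat.lt_succ_self _)
  rw [coeff_natTrailingDegree_eq_zero] at hcoeff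
  exact mul_ne_zero hlc hprod hcoeff

section additivePolynomials

open Polynomial

variable {F : Type} [Field F] [Fintype F]

/-- The additive polynomial `Σ_{j<l} a_j X^{q^j}` with coefficient vector `a`. -/
def additivePoly {l : ℕ} (a : Fin l → F) : F[X] :=
  ∑ j : Fin l, C (a j) * X ^ (Fintype.card F ^ (j : ℕ))

theorem sMap_eq_additivePoly (k : ℕ) (a : F[X]) :
    sMap F k a = additivePoly fun j : Fin k => a.coeff j :=
  Finset.sum_range fun j => C (a.coeff j) * X ^ (Fintype.card F ^ j)

theorem sMap_ofFn {l k : ℕ} (hlk : l ≤ k) (a : Fin l → F) :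
    sMap F k (ofFn l a) = additivePoly a := by
  rw [sMap, ← Finset.sum_subset (Finset.range_mono hlk), Finset.sum_range, additivePoly]
  · exact Finset.sum_congr rfl fun j _ => by rw [ofFn_coeff_eq_val_of_lt a j.2]
  · intro j _ hj
    rw [ofFn_coeff_eq_zero_of_ge a (by simpa using hj), C_0, zero_mul]

theorem coeff_additivePoly {l : ℕ} (a : Fin l → F) (i : Fin l) :
    (additivePoly a).coeff (Fintype.card F ^ (i : ℕ)) = a i := by
  rw [additivePoly, finsetSum_coeff, Finset.sum_eq_single i]
  · simp
  · intro j _ hj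
    rw [coeff_C_mul, coeff_X_pow, if_neg, mul_zero]
    intro h
    exact hj (Fin.ext (Nat.pow_right_injective Fintype.one_lt_card h).symm)
  · simp

theorem additivePoly_injective (l : ℕ) :
    Function.Injective (additivePoly : (Fin l → F) → F[X]) := fun a b h => by
  ext i
  rw [← coeff_additivePoly a i, h, coeff_additivePoly]

theorem additivePoly_sub {l : ℕ} (a b : Fin l → F) :
    additivePoly (a - b) = additivePoly a - additivePoly b := by
  simp [additivePoly, sub_mul, Finset.sum_sub_distrib]

theorem additivePoly_zero (l : ℕ) : additivePoly (0 : Fin l → F) = 0 := by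
  simp [additivePoly]

theorem coeff_additivePoly_of_le {l m : ℕ} (a : Fin l → F) (hm : Fintype.card F ^ l ≤ m) :
    (additivePoly a).coeff m = 0 := by
  rw [additivePoly, finsetSum_coeff]
  refine Finset.sum_eq_zero fun j _ => ?_
  rw [coeff_C_mul, coeff_X_pow, if_neg, mul_zero]
  exact ((Nat.pow_lt_pow_right Fintype.one_lt_card j.2).trans_le hm).ne'

theorem natTrailingDegree_additivePoly_snoc_le {l : ℕ} (c : F) (a : Fin l → F) :
    (additivePoly (Fin.snoc a c : Fin (l + 1) → F)).natTrailingDegree ≤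
      (additivePoly a).natTrailingDegree + if a = 0 ∧ c ≠ 0 then Fintype.card F ^ l else 0 := by
  have hsnoc : additivePoly (Fin.snoc a c : Fin (l + 1) → F) =
      additivePoly a + C c * X ^ (Fintype.card F ^ l) := by
    simp [additivePoly, Fin.sum_univ_castSucc]
  rw [hsnoc]
  rcases eq_or_ne a 0 with rfl | ha
  · rcases eq_or_ne c 0 with rfl | hc
    · simp
    · rw [additivePoly_zero, zero_add, natTrailingDegree_zero, if_pos ⟨rfl, hc⟩, zero_add]
      exact natTrailingDegree_le_of_ne_zero (by simpa using hc)
  · have hpa : additivePoly a ≠ 0 := by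
      rw [← additivePoly_zero l]
      exact (additivePoly_injective l).ne ha
    have hlt : (additivePoly a).natTrailingDegree < Fintype.card F ^ l := by
      by_contra! h
      exact hpa (coeff_natTrailingDegree_eq_zero.1 (coeff_additivePoly_of_le a h))
    rw [if_neg fun h => ha h.1, add_zero]
    apply natTrailingDegree_le_of_ne_zero
    rw [coeff_add, coeff_C_mul, coeff_X_pow, if_neg hlt.ne, mul_zero, add_zero]
    exact mt coeff_natTrailingDegree_eq_zero.1 hpa

theorem sum_natTrailingDegree_additivePoly_le (l : ℕ) :
    ∑ a : Fin l → F, (additivePoly a).natTrailingDegree ≤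
      l * (Fintype.card F - 1) * Fintype.card F ^ (l - 1) := by
  induction l with
  | zero => simp [additivePoly]
  | succ l ih =>
    set q := Fintype.card F with hq
    rw [← (Fin.snocEquiv fun _ : Fin (l + 1) => F).sum_comp, Fintype.sum_prod_type]
    have hone : ∀ c : F, ∑ a : Fin l → F, (if a = 0 ∧ c ≠ 0 then q ^ l else 0) =
        if c ≠ 0 then q ^ l else 0 := by
      intro c
      rw [Finset.sum_eq_single 0] <;> simp +contextual
    have hcard : ∑ c : F, (if c ≠ 0 then q ^ l else 0) = (q - 1) * q ^ l := by
      rw [← Finset.sum_filter, Finset.sum_const, smul_eq_mul, Finset.filter_ne',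
        Finset.card_erase_of_mem (Finset.mem_univ _), Finset.card_univ]
    calc ∑ c : F, ∑ a : Fin l → F,
          (additivePoly (Fin.snoc a c : Fin (l + 1) → F)).natTrailingDegree
        ≤ ∑ c : F, ∑ a : Fin l → F, ((additivePoly a).natTrailingDegree +
            if a = 0 ∧ c ≠ 0 then q ^ l else 0) :=
          Finset.sum_le_sum fun c _ => Finset.sum_le_sum fun a _ =>
            natTrailingDegree_additivePoly_snoc_le c a
      _ = q * ∑ a : Fin l → F, (additivePoly a).natTrailingDegree + (q - 1) * q ^ l := by
          simp_rw [Finset.sum_add_distrib, hone, hcard]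
          simp [hq]
      _ ≤ q * (l * (q - 1) * q ^ (l - 1)) + (q - 1) * q ^ l := by gcongr
      _ = (l + 1) * (q - 1) * q ^ (l + 1 - 1) := by
          cases l with
          | zero => simp
          | succ l => simp only [Nat.add_sub_cancel]; ring

theorem exists_eval_sMap_natTrailingDegree_le (k : ℕ) (p : F[X][X]) (hp : p ≠ 0)
    (hd : p.natDegree < Fintype.card F ^ k) :
    ∃ a : F[X], a.degree < k ∧ p.eval (sMap F k a) ≠ 0 ∧
      (p.eval (sMap F k a)).natTrailingDegree ≤
        p.leadingCoeff.natTrailingDegree + p.natDegree * (k * (Fintype.card F - 1)) := by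
  set q := Fintype.card F with hq
  have hq1 : 1 < q := Fintype.one_lt_card
  set d := p.natDegree
  set l := Nat.clog q (d + 1) with hl
  have hlk : l ≤ k := Nat.clog_le_of_le_pow hd
  have hdl : d + 1 ≤ q ^ l := Nat.le_pow_clog hq1 _
  have hM : l * (q - 1) * q ^ (l - 1) ≤ d * (k * (q - 1)) := by
    rcases Nat.eq_zero_or_pos d with h0 | h0
    · simp [hl, h0]
    · have : q ^ (l - 1) < d + 1 := Nat.pow_pred_clog_lt_self hq1 (by omega)
      calc l * (q - 1) * q ^ (l - 1) ≤ k * (q - 1) * d := by gcongr; omega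
        _ = d * (k * (q - 1)) := mul_comm _ _
  obtain ⟨s, -, hs⟩ := Finset.exists_subset_card_eq (s := (Finset.univ : Finset (Fin l → F)))
    (n := d + 1) (by simpa using hdl)
  obtain ⟨a, -, h0, hle⟩ := p.exists_eval_natTrailingDegree_le hp s additivePoly
    (additivePoly_injective l).injOn hs (M := d * (k * (q - 1))) fun i _ => by
      calc ∑ j ∈ s.erase i, (additivePoly i - additivePoly j).natTrailingDegree
          ≤ ∑ j, (additivePoly i - additivePoly j).natTrailingDegree :=
            Finset.sum_le_sum_of_subset (Finset.subset_univ _)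
        _ = ∑ j, (additivePoly (Equiv.subLeft i j)).natTrailingDegree := by
            simp [additivePoly_sub]
        _ = ∑ j : Fin l → F, (additivePoly j).natTrailingDegree :=
            (Equiv.subLeft i).sum_comp fun j => (additivePoly j).natTrailingDegree
        _ ≤ _ := (sum_natTrailingDegree_additivePoly_le l).trans hM
  refine ⟨ofFn l a, (ofFn_degree_lt a).trans_le (by exact_mod_cast hlk), ?_⟩
  rw [sMap_ofFn hlk]
  exact ⟨h0, hle⟩

theorem exists_mvEval_sMap_natTrailingDegree_le (k n : ℕ)
    (f : MvPolynomial (Fin n) F[X]) (α : Fin n →₀ ℕ) (hα : ∀ j, α j < Fintype.card F ^ k)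
    (hc : f.coeff α ≠ 0)
    (hlead : ∀ β ∈ f.support, β = α ∨ ∃ i : Fin n, β i < α i ∧ ∀ j : Fin n, j < i → β j = α j) :
    ∃ y : Fin n → F[X], (∀ i, ∃ a : F[X], a.degree < k ∧ y i = sMap F k a) ∧
      MvPolynomial.eval y f ≠ 0 ∧ (MvPolynomial.eval y f).natTrailingDegree ≤
        (f.coeff α).natTrailingDegree + (∑ j, α j) * (k * (Fintype.card F - 1)) := by
  induction n with
  | zero =>
    obtain ⟨c, rfl⟩ := MvPolynomial.C_surjective (Fin 0) f
    obtain rfl : α = 0 := Subsingleton.elim _ _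
    refine ⟨Fin.elim0, fun i => i.elim0, ?_⟩
    simpa using hc
  | succ n ih =>
    set P := MvPolynomial.finSuccEquiv F[X] n f
    have htail : ∀ β : Fin n →₀ ℕ, ∀ m : ℕ, (P.coeff m).coeff β = f.coeff (β.cons m) :=
      fun β m => MvPolynomial.finSuccEquiv_coeff_coeff β f m
    have hg : (P.coeff (α 0)).coeff α.tail = f.coeff α := by rw [htail, Finsupp.cons_tail]
    obtain ⟨y, hy, hy0, hyle⟩ := ih (P.coeff (α 0)) α.tail (fun j => hα j.succ)
      (by rwa [hg]) fun β hβ => by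
        rw [MvPolynomial.mem_support_iff, htail, ← MvPolynomial.mem_support_iff] at hβ
        rcases hlead _ hβ with h | ⟨i, hi, hlt⟩
        · left
          rw [← h, Finsupp.tail_cons]
        · right
          cases i using Fin.cases with
          | zero => simp at hi
          | succ i =>
            refine ⟨i, hi, fun j hj => ?_⟩
            exact hlt j.succ (Fin.succ_lt_succ_iff.2 hj)
    have hhigh : ∀ m, α 0 < m → P.coeff m = 0 := by
      intro m hm
      ext1 β
      rw [htail, MvPolynomial.coeff_zero]
      by_contra hne
      rcases hlead _ (MvPolynomial.mem_support_iff.2 hne) with h | ⟨i, hi, hlt⟩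
      · rw [← h, Finsupp.cons_zero] at hm
        exact lt_irrefl _ hm
      · cases i using Fin.cases with
        | zero => rw [Finsupp.cons_zero] at hi; omega
        | succ i =>
          have := hlt 0 (Fin.succ_pos i)
          rw [Finsupp.cons_zero] at this
          omega
    set p : F[X][X] := P.map (MvPolynomial.eval y) with hp
    have hpc : p.coeff (α 0) = MvPolynomial.eval y (P.coeff (α 0)) := coeff_map _ _
    have hdeg : p.natDegree = α 0 := by
      refine natDegree_eq_of_le_of_coeff_ne_zero ?_ (by rwa [hpc])
      exact natDegree_le_iff_coeff_eq_zero.2 fun m hm => by rw [hp, coeff_map, hhigh m hm, map_zero]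
    have hlc : p.leadingCoeff = MvPolynomial.eval y (P.coeff (α 0)) := by
      rw [leadingCoeff, hdeg, hpc]
    have hpne : p ≠ 0 := leadingCoeff_ne_zero.1 (by rwa [hlc])
    obtain ⟨a, hak, ha0, hale⟩ :=
      exists_eval_sMap_natTrailingDegree_le k p hpne (by rw [hdeg]; exact hα 0)
    refine ⟨Fin.cons (sMap F k a) y, fun i => ?_, ?_⟩
    · cases i using Fin.cases with
      | zero => exact ⟨a, hak, rfl⟩
      | succ i => exact hy i
    · rw [MvPolynomial.eval_eq_eval_mv_eval']
      refine ⟨ha0, hale.trans ?_⟩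
      rw [hlc, hdeg, Fin.sum_univ_succ, add_mul]
      rw [hg] at hyle
      simp only [Finsupp.tail_apply] at hyle
      omega

end additivePolynomials

/-- **Discrete valuation Schwartz–Zippel lemma.** Let `f ∈ B[z_1,…,z_n]` be a
nonzero polynomial whose leading term with respect to the lexicographical
ordering is `c_α z^α` with `α_j < q^k` for all `j`. Then for all `0 < θ ≤ 1`,
the number of `y ∈ C^n` with `v_X(f(y)) ≥ v_X(c_α) + θnq^k` (counting also
those `y` with `f(y) = 0`) is strictly less than
`max{q^{nk}, |α|·k·q^{k(n−1)+1}/θ}`. -/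
theorem discrete_valuation_schwartz_zippel
    (Fq : Type) [Field Fq] [Fintype Fq] (n k : ℕ) (hn : 0 < n) (hk : 0 < k)
    (θ : ℝ) (hθ0 : 0 < θ) (hθ1 : θ ≤ 1)
    (f : MvPolynomial (Fin n) (Polynomial Fq)) (hf : f ≠ 0)
    (α : Fin n →₀ ℕ) (hαlt : ∀ j, α j < Fintype.card Fq ^ k)
    (hαsupp : MvPolynomial.coeff α f ≠ 0)
    -- `c_α z^α` is the leading term for the lexicographic order: every other
    -- monomial of `f` is lexicographically smaller than `α`.
    (hlead : ∀ β ∈ f.support, β = α ∨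
      ∃ i : Fin n, β i < α i ∧ ∀ j : Fin n, j < i → β j = α j) :
    ({y : Fin n → Polynomial Fq |
        (∀ i, ∃ a : Polynomial Fq, a.degree < (k : ℕ) ∧ y i = sMap Fq k a) ∧
        (MvPolynomial.eval y f = 0 ∨
          ((MvPolynomial.coeff α f).natTrailingDegree : ℝ)
              + θ * (n : ℝ) * (Fintype.card Fq : ℝ) ^ k
            ≤ ((MvPolynomial.eval y f).natTrailingDegree : ℝ))}.ncard : ℝ)
      < max ((Fintype.card Fq : ℝ) ^ (n * k))
          ((∑ j, α j : ℝ) * (k : ℝ) * (Fintype.card Fq : ℝ) ^ (k * (n - 1) + 1) / θ) := by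
  set q := Fintype.card Fq with hq
  have hq1 : 1 < q := Fintype.one_lt_card
  have hq0 : (0 : ℝ) < q := by exact_mod_cast hq1.le
  set S : Set (Fin n → Polynomial Fq) := {y | _}
  let Φ : (Fin n → Fin k → Fq) → Fin n → Polynomial Fq := fun a i => additivePoly (a i)
  have hmem : ∀ y : Fin n → Polynomial Fq,
      (∀ i, ∃ a : Polynomial Fq, a.degree < (k : ℕ) ∧ y i = sMap Fq k a) → y ∈ Set.range Φ := by
    intro y hy
    choose a _ ha using hy
    exact ⟨fun i j => (a i).coeff j, funext fun i => by rw [ha, sMap_eq_additivePoly]⟩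
  have hsub : S ⊆ Set.range Φ := fun y hy => hmem y hy.1
  have hrange : (Set.range Φ).ncard ≤ q ^ (n * k) := by
    rw [← Set.image_univ]
    refine (Set.ncard_image_le Set.finite_univ).trans (le_of_eq ?_)
    rw [Set.ncard_univ, Nat.card_eq_fintype_card]
    simp [← hq, ← pow_mul, mul_comm]
  rcases lt_or_ge ((q : ℝ) ^ (n * k))
    ((∑ j, α j : ℝ) * (k : ℝ) * (q : ℝ) ^ (k * (n - 1) + 1) / θ) with hlt | hge
  · refine lt_max_of_lt_right (lt_of_le_of_lt ?_ hlt)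
    exact_mod_cast (Set.ncard_le_ncard hsub (Set.finite_range Φ)).trans hrange
  · refine lt_max_of_lt_left ?_
    obtain ⟨y, hyC, hy0, hyle⟩ :=
      exists_mvEval_sMap_natTrailingDegree_le k n f α hαlt hαsupp hlead
    have hsmall : ((∑ j, α j : ℕ) : ℝ) * (k * q) ≤ θ * (q : ℝ) ^ k := by
      rw [div_le_iff₀ hθ0] at hge
      have hexp : n * k = k * (n - 1) + k := by
        obtain ⟨m, rfl⟩ := Nat.exists_eq_add_of_lt hn
        simp only [zero_add, Nat.add_sub_cancel]
        ring
      rw [hexp, pow_add, pow_add, pow_one] at hge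
      refine le_of_mul_le_mul_left ?_ (pow_pos hq0 (k * (n - 1)))
      push_cast
      linarith
    have hstrict : (((∑ j, α j) * (k * (q - 1)) : ℕ) : ℝ) < θ * n * (q : ℝ) ^ k := by
      have hn1 : (1 : ℝ) ≤ n := by exact_mod_cast hn
      have hpos : 0 < θ * (q : ℝ) ^ k := by positivity
      have hle : θ * (q : ℝ) ^ k ≤ θ * n * (q : ℝ) ^ k := by nlinarith
      refine lt_of_lt_of_le ?_ hle
      rcases Nat.eq_zero_or_pos (∑ j, α j) with h0 | h0
      · simpa [h0] using hpos
      · refine lt_of_lt_of_le ?_ hsmall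
        have : (∑ j, α j) * (k * (q - 1)) < (∑ j, α j) * (k * q) := by
          gcongr
          omega
        exact_mod_cast this
    have hyS : y ∉ S := by
      rintro ⟨-, h | h⟩
      · exact hy0 h
      · have : ((MvPolynomial.eval y f).natTrailingDegree : ℝ) ≤
          (MvPolynomial.coeff α f).natTrailingDegree + (((∑ j, α j) * (k * (q - 1)) : ℕ) : ℝ) := by
          exact_mod_cast hyle
        linarith
    have hss : S ⊂ Set.range Φ := ⟨hsub, fun h => hyS (h (hmem y hyC))⟩
    exact_mod_cast (Set.ncard_lt_ncard hss (Set.finite_range Φ)).trans_le hrange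
end
end

section
/- Let q be a prime power, let n, k > 0 be integers, let ε, ν ∈ (0,1), and let R = A/t^kA. Then every (ε,ν)-Kakeya set E ⊆ R^n modulo t^k satisfies |E| ≥ C(⌊(νε/(kn))·q^{k−1}⌋ + n, n), where C(m, n) denotes the binomial coefficient. -/
open scoped Classical
noncomputable section

/-- The order of vanishing at `0` of a power series, truncated at `M`. -/
def truncOrder {κ : Type*} [Field κ] (M : ℕ) (p : PowerSeries κ) : ℕ :=
  (min (M : ℕ∞) (emultiplicity PowerSeries.X p)).toNat

section TruncOrder

variable {κ : Type*} [Field κ]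

theorem coe_truncOrder (M : ℕ) (p : PowerSeries κ) :
    (truncOrder M p : ℕ∞) = min (M : ℕ∞) (emultiplicity PowerSeries.X p) :=
  ENat.natCast_toNat (ne_top_of_le_ne_top (ENat.natCast_ne_top M) (min_le_left _ _))

theorem truncOrder_le (M : ℕ) (p : PowerSeries κ) : truncOrder M p ≤ M := by
  have h := min_le_left (M : ℕ∞) (emultiplicity PowerSeries.X p)
  rw [← coe_truncOrder] at h
  exact_mod_cast h

theorem truncOrder_mul_le (M : ℕ) (p r : PowerSeries κ) :
    truncOrder M (p * r) ≤ truncOrder M p + truncOrder M r := by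
  have h : (truncOrder M (p * r) : ℕ∞) ≤ truncOrder M p + truncOrder M r := by
    simp only [coe_truncOrder, emultiplicity_mul PowerSeries.X_prime]
    rcases le_total (M : ℕ∞) (emultiplicity PowerSeries.X p) with h1 | h1
    · rw [min_eq_left h1]
      exact (min_le_left _ _).trans le_self_add
    rcases le_total (M : ℕ∞) (emultiplicity PowerSeries.X r) with h2 | h2
    · rw [min_eq_left h2]
      exact (min_le_left _ _).trans le_add_self
    · rw [min_eq_right h1, min_eq_right h2]
      exact min_le_right _ _
  exact_mod_cast h

theorem truncOrder_le_of_not_dvd {M c : ℕ} {p : PowerSeries κ}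
    (h : ¬ PowerSeries.X ^ (c + 1) ∣ p) : truncOrder M p ≤ c := by
  rw [pow_dvd_iff_le_emultiplicity, not_le] at h
  have h1 : (truncOrder M p : ℕ∞) < ((c + 1 : ℕ) : ℕ∞) := by
    rw [coe_truncOrder]
    exact (min_le_right _ _).trans_lt h
  have h2 : truncOrder M p < c + 1 := by exact_mod_cast h1
  omega

theorem truncOrder_of_pow_dvd {M : ℕ} {p : PowerSeries κ} (h : PowerSeries.X ^ M ∣ p) :
    truncOrder M p = M := by
  rw [pow_dvd_iff_le_emultiplicity] at h
  rw [truncOrder, min_eq_left h, ENat.toNat_natCast]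

theorem truncOrder_X_pow_le (M c : ℕ) : truncOrder M (PowerSeries.X ^ c : PowerSeries κ) ≤ c := by
  apply truncOrder_le_of_not_dvd
  rw [PowerSeries.X_pow_dvd_iff]
  intro h
  simpa [PowerSeries.coeff_X_pow] using h c (Nat.lt_succ_self c)

theorem truncOrder_C {M : ℕ} {a : κ} (ha : a ≠ 0) : truncOrder M (PowerSeries.C a) = 0 := by
  apply Nat.le_zero.mp
  apply truncOrder_le_of_not_dvd
  rw [zero_add, pow_one, PowerSeries.X_dvd_iff]
  simpa using ha

/-- A polynomial over `κ⟦X⟧` is a power of `X` times a polynomial which is nonzero modulo `X`. -/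
theorem exists_eq_C_X_pow_mul (e c : ℕ) (f : Polynomial (PowerSeries κ))
    (h : ¬ PowerSeries.X ^ (c + 1) ∣ f.coeff e) :
    ∃ c₀ ≤ c, ∃ f₀ : Polynomial (PowerSeries κ),
      f = Polynomial.C (PowerSeries.X ^ c₀) * f₀ ∧
        f₀.map PowerSeries.constantCoeff ≠ 0 := by
  induction c generalizing f with
  | zero =>
    refine ⟨0, le_rfl, f, by simp, fun h0 => h ?_⟩
    rw [zero_add, pow_one, PowerSeries.X_dvd_iff, ← Polynomial.coeff_map, h0,
      Polynomial.coeff_zero]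
  | succ c ih =>
    by_cases h0 : f.map PowerSeries.constantCoeff = 0
    · obtain ⟨f₁, rfl⟩ : Polynomial.C PowerSeries.X ∣ f := by
        rw [Polynomial.C_dvd_iff_dvd_coeff]
        intro i
        rw [PowerSeries.X_dvd_iff, ← Polynomial.coeff_map, h0, Polynomial.coeff_zero]
      obtain ⟨c₀, hc₀, f₀, rfl, hf₀⟩ := ih f₁ (fun hd => h (by
        rw [Polynomial.coeff_C_mul, pow_succ']
        exact mul_dvd_mul_left _ hd))
      exact ⟨c₀ + 1, by omega, f₀, by rw [pow_succ', Polynomial.C_mul, mul_assoc], hf₀⟩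
    · exact ⟨0, Nat.zero_le _, f, by simp, h0⟩

end TruncOrder

theorem sum_fin_succ_pi {α M : Type*} [Fintype α] [AddCommMonoid M] {n : ℕ}
    (f : (Fin (n + 1) → α) → M) :
    ∑ w, f w = ∑ w : Fin n → α, ∑ a : α, f (Fin.cons a w) := by
  rw [← (Fin.consEquiv fun _ => α).sum_comp, Fintype.sum_prod_type_right]
  rfl

section DigitSums

variable (F : Type*) {κ : Type*} [Field F] [Fintype F] [Field κ] [Algebra F κ]

theorem sum_rootMultiplicity_le (p : Polynomial κ) :
    ∑ a : F, p.rootMultiplicity (algebraMap F κ a) ≤ p.natDegree := by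
  classical
  calc ∑ a : F, p.rootMultiplicity (algebraMap F κ a)
      = ∑ b ∈ Finset.univ.map ⟨algebraMap F κ, (algebraMap F κ).injective⟩, p.roots.count b := by
        simp [Polynomial.count_roots]
    _ ≤ ∑ b ∈ Finset.univ.map ⟨algebraMap F κ, (algebraMap F κ).injective⟩ ∪ p.roots.toFinset,
          p.roots.count b := Finset.sum_le_sum_of_subset Finset.subset_union_left
    _ = p.roots.card := Multiset.sum_count_eq_card (by
        intro a ha
        exact Finset.mem_union_right _ (Multiset.mem_toFinset.mpr ha))
    _ ≤ p.natDegree := p.card_roots'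

variable {F}

/-- The power series `∑ l < k, w l * X ^ (q ^ (j + l) - q ^ j)`. -/
def digitSeries (κ : Type*) [Field κ] [Algebra F κ] (j k : ℕ) (w : Fin k → F) : PowerSeries κ :=
  ∑ l : Fin k, PowerSeries.C (algebraMap F κ (w l)) *
    PowerSeries.X ^ (Fintype.card F ^ (j + l) - Fintype.card F ^ j)

theorem digitSeries_cons (j k : ℕ) (a : F) (w : Fin k → F) :
    digitSeries κ j (k + 1) (Fin.cons a w) = PowerSeries.C (algebraMap F κ a) +
      PowerSeries.X ^ (Fintype.card F ^ (j + 1) - Fintype.card F ^ j) *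
        digitSeries κ (j + 1) k w := by
  have hq : 1 ≤ Fintype.card F := Fintype.card_pos
  simp only [digitSeries, Fin.sum_univ_succ, Fin.cons_zero, Fin.cons_succ, Fin.val_zero, add_zero,
    Nat.sub_self, pow_zero, mul_one, Fin.val_succ, Finset.mul_sum]
  congr 1
  refine Finset.sum_congr rfl fun l _ => ?_
  have h1 := Nat.pow_le_pow_right hq (show j ≤ j + 1 by omega)
  have h2 := Nat.pow_le_pow_right hq (show j + 1 ≤ j + 1 + l by omega)
  rw [mul_left_comm, ← pow_add, show j + (l.val + 1) = j + 1 + l by ring]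
  congr 2
  omega

/-- The shifted and rescaled polynomial `f (a + X ^ g * y)`. -/
def rescale (f : Polynomial (PowerSeries κ)) (a : κ) (g : ℕ) : Polynomial (PowerSeries κ) :=
  (Polynomial.taylor (PowerSeries.C a) f).comp (Polynomial.C (PowerSeries.X ^ g) * Polynomial.X)

theorem eval_rescale (f : Polynomial (PowerSeries κ)) (a : κ) (g : ℕ) (y : PowerSeries κ) :
    (rescale f a g).eval y = f.eval (PowerSeries.C a + PowerSeries.X ^ g * y) := by
  simp [rescale, Polynomial.taylor_eval, add_comm]

theorem coeff_rescale (f : Polynomial (PowerSeries κ)) (a : κ) (g i : ℕ) :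
    (rescale f a g).coeff i =
      (Polynomial.taylor (PowerSeries.C a) f).coeff i * PowerSeries.X ^ (g * i) := by
  rw [rescale, Polynomial.comp_C_mul_X_coeff, pow_mul]

theorem not_pow_dvd_coeff_rescale (f : Polynomial (PowerSeries κ)) (a : κ) (g : ℕ)
    (hf : f.map PowerSeries.constantCoeff ≠ 0) :
    ¬ PowerSeries.X ^ (g * (f.map PowerSeries.constantCoeff).rootMultiplicity a + 1) ∣
      (rescale f a g).coeff ((f.map PowerSeries.constantCoeff).rootMultiplicity a) := by
  rw [coeff_rescale, pow_succ', mul_dvd_mul_iff_right (pow_ne_zero _ PowerSeries.X_ne_zero),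
    PowerSeries.X_dvd_iff, ← Polynomial.coeff_map, Polynomial.map_taylor,
    Polynomial.rootMultiplicity_eq_natTrailingDegree, PowerSeries.constantCoeff_C,
    ← Polynomial.taylor_apply, Polynomial.coeff_natTrailingDegree_eq_zero]
  simpa using hf

theorem sum_truncOrder_digitSeries_le (M j k : ℕ) (f : Polynomial (PowerSeries κ)) (e c : ℕ)
    (hc : ¬ PowerSeries.X ^ (c + 1) ∣ f.coeff e)
    (he : ∀ i > e, PowerSeries.X ^ (c + 1) ∣ f.coeff i) :
    ∑ w : Fin k → F, truncOrder M (f.eval (digitSeries κ j k w)) ≤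
      Fintype.card F ^ k * c +
        e * (M + k * (Fintype.card F ^ (j + k) - Fintype.card F ^ (j + k - 1))) := by
  induction k generalizing j f e c with
  | zero =>
    rw [Fintype.sum_unique]
    rcases Nat.eq_zero_or_pos e with rfl | hpos
    · have h : f.eval (digitSeries κ j 0 (default : Fin 0 → F)) = f.coeff 0 := by
        simp [digitSeries, Polynomial.coeff_zero_eq_eval_zero]
      rw [h]
      simpa using truncOrder_le_of_not_dvd (M := M) hc
    · have := truncOrder_le M (f.eval (digitSeries κ j 0 (default : Fin 0 → F)))
      nlinarith
  | succ k ih =>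
    obtain ⟨c₀, hc₀, f₀, rfl, hf₀⟩ := exists_eq_C_X_pow_mul e c f hc
    set q := Fintype.card F with hq
    have hq1 : 1 < q := Fintype.one_lt_card
    set g := q ^ (j + 1) - q ^ j with hg
    have hgpos : 0 < g := Nat.sub_pos_of_lt (Nat.pow_lt_pow_right hq1 (Nat.lt_succ_self j))
    set p := f₀.map PowerSeries.constantCoeff with hp
    have hdeg : p.natDegree ≤ e := by
      rw [Polynomial.natDegree_le_iff_coeff_eq_zero]
      intro i hi
      have h := he i hi
      rw [Polynomial.coeff_C_mul, show c + 1 = c₀ + (c - c₀ + 1) by omega, pow_add,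
        mul_dvd_mul_iff_left (pow_ne_zero _ PowerSeries.X_ne_zero)] at h
      rw [hp, Polynomial.coeff_map, ← PowerSeries.X_dvd_iff]
      exact (dvd_pow_self _ (Nat.succ_ne_zero _)).trans h
    set D := M + k * (q ^ (j + 1 + k) - q ^ (j + 1 + k - 1)) with hD
    have key : ∀ a : F, ∑ w : Fin k → F, truncOrder M
        ((Polynomial.C (PowerSeries.X ^ c₀) * f₀).eval (digitSeries κ j (k + 1) (Fin.cons a w))) ≤
        q ^ k * c₀ + p.rootMultiplicity (algebraMap F κ a) * (q ^ k * g + D) := by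
      intro a
      have h1 := ih (j + 1) (rescale f₀ (algebraMap F κ a) g)
        (p.rootMultiplicity (algebraMap F κ a)) (g * p.rootMultiplicity (algebraMap F κ a))
        (not_pow_dvd_coeff_rescale _ _ _ hf₀) (by
          intro i hi
          rw [coeff_rescale]
          refine Dvd.dvd.mul_left (pow_dvd_pow _ ?_) _
          nlinarith)
      calc _ ≤ ∑ w : Fin k → F, (c₀ + truncOrder M ((rescale f₀ (algebraMap F κ a) g).eval
              (digitSeries κ (j + 1) k w))) := by
            refine Finset.sum_le_sum fun w _ => ?_
            rw [Polynomial.eval_mul, Polynomial.eval_C, digitSeries_cons, eval_rescale]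
            exact (truncOrder_mul_le _ _ _).trans
              (Nat.add_le_add_right (truncOrder_X_pow_le _ _) _)
        _ ≤ _ := by
            rw [Finset.sum_add_distrib]
            simp only [Finset.sum_const, Finset.card_univ, Fintype.card_pi, Finset.prod_const,
              Fintype.card_fin, smul_eq_mul, ← hq]
            refine (Nat.add_le_add_left h1 _).trans (le_of_eq ?_)
            rw [← hD]
            ring
    rw [sum_fin_succ_pi, Finset.sum_comm]
    calc _ ≤ ∑ a : F, (q ^ k * c₀ +
              p.rootMultiplicity (algebraMap F κ a) * (q ^ k * g + D)) :=
          Finset.sum_le_sum fun a _ => key a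
      _ ≤ q * (q ^ k * c₀) + e * (q ^ k * g + D) := by
          rw [Finset.sum_add_distrib]
          refine Nat.add_le_add (le_of_eq ?_) ((Finset.sum_mul _ _ _).ge.trans
            <| Nat.mul_le_mul_right _ ((sum_rootMultiplicity_le F p).trans hdeg))
          simp [hq]
      _ ≤ q ^ (k + 1) * c + e * (q ^ k * g + D) := by
          rw [← mul_assoc, ← pow_succ']
          gcongr
      _ = _ := by
          have h2 : q ^ k * g = q ^ (j + (k + 1)) - q ^ (j + (k + 1) - 1) := by
            rw [hg, Nat.mul_sub, ← pow_add, ← pow_add]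
            congr 2 <;> omega
          rw [h2, hD, show j + 1 + k = j + (k + 1) by ring]
          ring

/-- The power series `∑ l < k, w l * X ^ (q ^ l)`. -/
def frobeniusSeries (κ : Type*) [Field κ] [Algebra F κ] {k : ℕ} (w : Fin k → F) : PowerSeries κ :=
  ∑ l : Fin k, PowerSeries.C (algebraMap F κ (w l)) * PowerSeries.X ^ (Fintype.card F ^ (l : ℕ))

theorem frobeniusSeries_eq {k : ℕ} (w : Fin k → F) :
    frobeniusSeries κ w = PowerSeries.X * digitSeries κ 0 k w := by
  rw [frobeniusSeries, digitSeries, Finset.mul_sum]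
  refine Finset.sum_congr rfl fun l _ => ?_
  have h := Nat.one_le_pow l (Fintype.card F) Fintype.card_pos
  rw [mul_left_comm, ← pow_succ', zero_add, pow_zero, Nat.sub_add_cancel h]

theorem sum_truncOrder_frobeniusSeries_le (M k : ℕ) (f : Polynomial (PowerSeries κ)) (e : ℕ)
    (he : f.natDegree ≤ e) :
    ∑ w : Fin k → F, truncOrder M (f.eval (frobeniusSeries κ w)) ≤
      Fintype.card F ^ k * truncOrder M (f.coeff e) +
        e * (Fintype.card F ^ k + M + k * (Fintype.card F ^ k - Fintype.card F ^ (k - 1))) := by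
  by_cases h : PowerSeries.X ^ M ∣ f.coeff e
  · rw [truncOrder_of_pow_dvd h]
    refine le_add_right ?_
    calc _ ≤ ∑ _w : Fin k → F, M := Finset.sum_le_sum fun w _ => truncOrder_le _ _
      _ = _ := by simp
  · have hc : ¬ PowerSeries.X ^ (truncOrder M (f.coeff e) + 1) ∣ f.coeff e := by
      rw [pow_dvd_iff_le_emultiplicity, not_le] at h ⊢
      have h1 := coe_truncOrder M (f.coeff e)
      rw [min_eq_right h.le] at h1
      rw [← h1]
      exact_mod_cast Nat.lt_succ_self _
    have key := sum_truncOrder_digitSeries_le (F := F) M 0 k (rescale f 0 1) e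
      (truncOrder M (f.coeff e) + e) (by
        have h0 : Polynomial.taylor (PowerSeries.C (0 : κ)) f = f := by simp
        rw [coeff_rescale, h0, one_mul,
          show truncOrder M (f.coeff e) + e + 1 = truncOrder M (f.coeff e) + 1 + e by ring,
          pow_add, mul_dvd_mul_iff_right (pow_ne_zero _ PowerSeries.X_ne_zero)]
        exact hc) (by
        intro i hi
        have h0 : Polynomial.taylor (PowerSeries.C (0 : κ)) f = f := by simp
        rw [coeff_rescale, h0, Polynomial.coeff_eq_zero_of_natDegree_lt (he.trans_lt hi), zero_mul]
        exact dvd_zero _)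
    simp only [eval_rescale, map_zero, zero_add, pow_one] at key
    simp only [frobeniusSeries_eq]
    linarith

theorem aeval_cons_eq_eval_map_finSuccEquiv {R S : Type*} [CommRing R] [CommRing S] [Algebra R S]
    {n : ℕ} (s : Fin n → S) (y : S) (P : MvPolynomial (Fin (n + 1)) R) :
    MvPolynomial.aeval (Fin.cons y s : Fin (n + 1) → S) P =
      ((MvPolynomial.finSuccEquiv R n P).map (MvPolynomial.aeval s).toRingHom).eval y := by
  induction P using MvPolynomial.induction_on with
  | C a => simp [MvPolynomial.finSuccEquiv_apply]
  | add P Q hP hQ => simp [hP, hQ]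
  | mul_X P i hP =>
    rw [map_mul, hP, map_mul, Polynomial.map_mul, Polynomial.eval_mul]
    congr 1
    refine Fin.cases ?_ (fun i => ?_) i
    · rw [MvPolynomial.finSuccEquiv_X_zero]
      simp
    · rw [MvPolynomial.finSuccEquiv_X_succ]
      simp

/-- A valuative Schwartz–Zippel bound: the average order of vanishing of
`P (∑ l, w 0 l * X ^ (q ^ l), …)` over all digit vectors `w` is at most proportional to the
degree of `P`. -/
theorem sum_truncOrder_aeval_frobeniusSeries_le (M k n : ℕ) (P : MvPolynomial (Fin n) κ)
    (hP : P ≠ 0) :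
    Fintype.card F ^ k * ∑ w : Fin n → Fin k → F,
        truncOrder M (MvPolynomial.aeval (fun i => frobeniusSeries κ (w i)) P) ≤
      P.totalDegree *
        (Fintype.card F ^ k + M + k * (Fintype.card F ^ k - Fintype.card F ^ (k - 1))) *
          (Fintype.card F ^ k) ^ n := by
  set q := Fintype.card F with hq
  set D := q ^ k + M + k * (q ^ k - q ^ (k - 1)) with hD
  induction n with
  | zero =>
    obtain ⟨a, rfl⟩ := MvPolynomial.C_surjective (Fin 0) P
    have ha : a ≠ 0 := by
      rintro rfl
      simp at hP
    simp [truncOrder_C ha]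
  | succ n ih =>
    set p := MvPolynomial.finSuccEquiv κ n P with hp
    have hp0 : p ≠ 0 := by simpa [hp] using hP
    have hlead : p.coeff p.natDegree ≠ 0 := by simpa using hp0
    have hdeg := MvPolynomial.totalDegree_coeff_finSuccEquiv_add_le P p.natDegree hlead
    have key : ∀ w : Fin n → Fin k → F, ∑ u : Fin k → F, truncOrder M (MvPolynomial.aeval
          (Fin.cons (frobeniusSeries κ u) fun i => frobeniusSeries κ (w i) :
            Fin (n + 1) → PowerSeries κ) P) ≤
        q ^ k * truncOrder M (MvPolynomial.aeval (fun i => frobeniusSeries κ (w i))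
          (p.coeff p.natDegree)) + p.natDegree * D := by
      intro w
      set φ : MvPolynomial (Fin n) κ →+* PowerSeries κ :=
        (MvPolynomial.aeval (fun i => frobeniusSeries κ (w i))).toRingHom with hφ
      have h := sum_truncOrder_frobeniusSeries_le (F := F) M k (p.map φ) p.natDegree
        Polynomial.natDegree_map_le
      rw [Polynomial.coeff_map] at h
      simp only [aeval_cons_eq_eval_map_finSuccEquiv]
      exact h
    have hcons : ∀ (u : Fin k → F) (w : Fin n → Fin k → F),
        (fun i => frobeniusSeries κ ((Fin.cons u w : Fin (n + 1) → Fin k → F) i)) =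
          (Fin.cons (frobeniusSeries κ u) fun i => frobeniusSeries κ (w i) :
            Fin (n + 1) → PowerSeries κ) := by
      intro u w
      funext i
      refine Fin.cases ?_ (fun i => ?_) i <;> rfl
    rw [sum_fin_succ_pi]
    simp only [hcons]
    calc _ ≤ q ^ k * ∑ w : Fin n → Fin k → F, (q ^ k * truncOrder M (MvPolynomial.aeval
          (fun i => frobeniusSeries κ (w i)) (p.coeff p.natDegree)) + p.natDegree * D) :=
          Nat.mul_le_mul_left _ (Finset.sum_le_sum fun w _ => key w)
      _ = q ^ k * (q ^ k * ∑ w : Fin n → Fin k → F, truncOrder M (MvPolynomial.aeval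
          (fun i => frobeniusSeries κ (w i)) (p.coeff p.natDegree))) +
          p.natDegree * D * (q ^ k) ^ (n + 1) := by
          rw [Finset.sum_add_distrib, ← Finset.mul_sum]
          simp only [Finset.sum_const, Finset.card_univ, Fintype.card_pi, Finset.prod_const,
            Fintype.card_fin, smul_eq_mul, ← hq]
          ring
      _ ≤ q ^ k * ((p.coeff p.natDegree).totalDegree * D * (q ^ k) ^ n) +
          p.natDegree * D * (q ^ k) ^ (n + 1) :=
          Nat.add_le_add_right (Nat.mul_le_mul_left _ (ih _ hlead)) _
      _ = ((p.coeff p.natDegree).totalDegree + p.natDegree) * D * (q ^ k) ^ (n + 1) := by ring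
      _ ≤ _ := by gcongr

end DigitSums

section TruncatedPowerSeries

variable {F : Type} [Field F] {k : ℕ}

/-- The representative of degree less than `k` of an element of `F⟦t⟧ / t ^ k`. -/
def Rk.toPoly (r : Rk F k) : Polynomial F :=
  PowerSeries.trunc k (Quotient.out r)

theorem mk_eq_mk_iff (f g : PowerSeries F) :
    (Ideal.Quotient.mk _ f : Rk F k) = Ideal.Quotient.mk _ g ↔
      ∀ l < k, PowerSeries.coeff l f = PowerSeries.coeff l g := by
  rw [Ideal.Quotient.eq, Ideal.mem_span_singleton, PowerSeries.X_pow_dvd_iff]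
  simp only [map_sub, sub_eq_zero]

theorem Rk.mk_toPoly (r : Rk F k) :
    (Ideal.Quotient.mk _ (r.toPoly : PowerSeries F) : Rk F k) = r := by
  conv_rhs => rw [← Ideal.Quotient.mk_out r]
  rw [mk_eq_mk_iff]
  intro l hl
  exact PowerSeries.coeff_coe_trunc_of_lt hl

theorem Rk.toPoly_eq_sum (r : Rk F k) :
    r.toPoly = ∑ l ∈ Finset.range k, Polynomial.C (r.toPoly.coeff l) * Polynomial.X ^ l := by
  ext m
  simp only [Rk.toPoly, PowerSeries.coeff_trunc, Polynomial.finsetSum_coeff,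
    Polynomial.coeff_C_mul_X_pow, Finset.sum_ite_eq, Finset.mem_range]
  split_ifs <;> rfl

theorem Rk.ext_coeff {r s : Rk F k}
    (h : ∀ l : Fin k, r.toPoly.coeff l = s.toPoly.coeff l) : r = s := by
  rw [← r.mk_toPoly, ← s.mk_toPoly, mk_eq_mk_iff]
  intro l hl
  simpa using h ⟨l, hl⟩

instance [Fintype F] : Finite (Rk F k) :=
  Finite.of_injective (fun (r : Rk F k) (l : Fin k) => r.toPoly.coeff l)
    fun _ _ h => Rk.ext_coeff (congrFun h)

theorem Rk.X_pow_dvd_sub_toPoly {r : Rk F k} {p : Polynomial F}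
    (hp : (Ideal.Quotient.mk _ (p : PowerSeries F) : Rk F k) = r) :
    Polynomial.X ^ k ∣ p - r.toPoly := by
  rw [← r.mk_toPoly, mk_eq_mk_iff] at hp
  rw [Polynomial.X_pow_dvd_iff]
  intro l hl
  simpa [sub_eq_zero] using hp l hl

variable {K : Type*} [AddCommGroup K] [Module F K]

/-- The `F⟦t⟧ / t ^ k`-orbit map of a `t ^ k`-torsion point `x`, where `t` acts as `Φ`. -/
def torsionMap (Φ : Module.End F K) (x : K) (r : Rk F k) : K :=
  Polynomial.aeval Φ r.toPoly x

variable {Φ : Module.End F K} {x : K}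

theorem aeval_eq_torsionMap (hx : (Φ ^ k) x = 0) {r : Rk F k} {p : Polynomial F}
    (hp : (Ideal.Quotient.mk _ (p : PowerSeries F) : Rk F k) = r) :
    Polynomial.aeval Φ p x = torsionMap Φ x r := by
  obtain ⟨s, hs⟩ := Rk.X_pow_dvd_sub_toPoly hp
  rw [torsionMap, ← sub_eq_zero, ← LinearMap.sub_apply, ← map_sub, hs, mul_comm]
  simp [hx]

theorem torsionMap_add (hx : (Φ ^ k) x = 0) (r s : Rk F k) :
    torsionMap Φ x (r + s) = torsionMap Φ x r + torsionMap Φ x s := by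
  rw [← aeval_eq_torsionMap hx (p := r.toPoly + s.toPoly)
    (by rw [Polynomial.coe_add, map_add, r.mk_toPoly, s.mk_toPoly])]
  simp [torsionMap]

theorem torsionMap_mul (hx : (Φ ^ k) x = 0) (r w : Rk F k) :
    torsionMap Φ x (r * w) = Polynomial.aeval Φ w.toPoly (torsionMap Φ x r) := by
  rw [← aeval_eq_torsionMap hx (p := w.toPoly * r.toPoly)
    (by rw [Polynomial.coe_mul, map_mul, r.mk_toPoly, w.mk_toPoly, mul_comm])]
  simp [torsionMap]

theorem pow_torsionMap (hx : (Φ ^ k) x = 0) (r : Rk F k) : (Φ ^ k) (torsionMap Φ x r) = 0 := by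
  have h : (Φ ^ k) (torsionMap Φ x r) =
      Polynomial.aeval Φ (Polynomial.X ^ k * r.toPoly) x := by simp [torsionMap]
  rw [h, mul_comm]
  simp [hx]

theorem X_pow_dvd_of_aeval_eq_zero (hx : (Φ ^ k) x = 0) (hx' : (Φ ^ (k - 1)) x ≠ 0)
    {p : Polynomial F} (hp : Polynomial.aeval Φ p x = 0) : Polynomial.X ^ k ∣ p := by
  suffices h : ∀ j ≤ k, Polynomial.X ^ j ∣ p from h k le_rfl
  intro j
  induction j with
  | zero => simp
  | succ j ih =>
    intro hj
    obtain ⟨s, rfl⟩ := ih (by omega)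
    have h1 : Polynomial.aeval Φ (Polynomial.X ^ (k - 1 - j) * (Polynomial.X ^ j * s)) x = 0 := by
      rw [map_mul, Module.End.mul_apply, hp, map_zero]
    have h2 : Polynomial.X ^ (k - 1 - j) * (Polynomial.X ^ j * s) =
        s.divX * Polynomial.X ^ k + Polynomial.C (s.coeff 0) * Polynomial.X ^ (k - 1) := by
      rw [← mul_assoc, ← pow_add, show k - 1 - j + j = k - 1 by omega]
      conv_lhs => rw [← s.divX_mul_X_add]
      rw [show (Polynomial.X : Polynomial F) ^ k = Polynomial.X ^ (k - 1) * Polynomial.X by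
        rw [← pow_succ]; congr 1; omega]
      ring
    rw [h2] at h1
    have h3 : s.coeff 0 • (Φ ^ (k - 1)) x = 0 := by
      simpa [hx, Algebra.algebraMap_eq_smul_one] using h1
    rw [pow_succ]
    refine mul_dvd_mul_left _ (Polynomial.X_dvd_iff.mpr ?_)
    exact (smul_eq_zero.mp h3).resolve_right hx'

theorem torsionMap_injective (hx : (Φ ^ k) x = 0) (hx' : (Φ ^ (k - 1)) x ≠ 0) :
    Function.Injective (torsionMap Φ x : Rk F k → K) := by
  intro r s h
  have h1 : Polynomial.X ^ k ∣ r.toPoly - s.toPoly :=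
    X_pow_dvd_of_aeval_eq_zero hx hx' (by
      rw [map_sub, LinearMap.sub_apply, sub_eq_zero]
      exact h)
  rw [Polynomial.X_pow_dvd_iff] at h1
  exact Rk.ext_coeff fun l => sub_eq_zero.mp (by simpa using h1 l l.2)

end TruncatedPowerSeries

section LubinTate

/-- The polynomial `X ^ q + T * X` over a valuation ring containing `T`. -/
def lubinTatePoly (F : Type) [Fintype F] {K : Type*} [Field K] {B : ValuationSubring K} (T : B) :
    Polynomial B :=
  Polynomial.X ^ Fintype.card F + Polynomial.C T * Polynomial.X

theorem map_iterate_lubinTatePoly (F : Type) [Fintype F] {K : Type*} [Field K]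
    {B : ValuationSubring K} {T : B} 
    (hT : T ∈ IsLocalRing.maximalIdeal B) (l : ℕ) :
    ((lubinTatePoly F T).comp^[l] Polynomial.X).map (IsLocalRing.residue B) =
      Polynomial.X ^ (Fintype.card F ^ l) := by
  induction l with
  | zero => simp
  | succ l ih =>
    have h : IsLocalRing.residue B T = 0 := (IsLocalRing.residue_eq_zero_iff T).mpr hT
    rw [Function.iterate_succ_apply', Polynomial.map_comp, ih]
    simp [lubinTatePoly, h, ← pow_mul, pow_succ]

variable (F : Type) {K : Type*} [Field F] [Fintype F] [Field K] [Algebra F K]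

/-- The `F`-linear map `x ↦ x ^ q + T * x`. -/
def lubinTate (T : K) : Module.End F K :=
  (FiniteField.frobeniusAlgHom F K).toLinearMap + LinearMap.mulLeft F T

variable {F}

@[simp]
theorem lubinTate_apply (T x : K) : lubinTate F T x = x ^ Fintype.card F + T * x := by
  simp [lubinTate]

theorem lubinTate_surjective [IsAlgClosed K] (T : K) : Function.Surjective (lubinTate F T) := by
  intro c
  have hq : 1 < Fintype.card F := Fintype.one_lt_card
  have hdeg : (Polynomial.X ^ Fintype.card F +
      (Polynomial.C T * Polynomial.X - Polynomial.C c) : Polynomial K).degree =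
        Fintype.card F := by
    refine (Polynomial.degree_add_eq_left_of_degree_lt ?_).trans (Polynomial.degree_X_pow _)
    rw [Polynomial.degree_X_pow, sub_eq_add_neg, ← Polynomial.C_neg]
    exact Polynomial.degree_linear_le.trans_lt (by exact_mod_cast hq)
  obtain ⟨y, hy⟩ := IsAlgClosed.exists_root _
    (by rw [hdeg]; exact_mod_cast (show Fintype.card F ≠ 0 by omega))
  refine ⟨y, ?_⟩
  simp only [Polynomial.IsRoot.def, Polynomial.eval_add, Polynomial.eval_pow, Polynomial.eval_X,
    Polynomial.eval_sub, Polynomial.eval_mul, Polynomial.eval_C] at hy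
  rw [lubinTate_apply]
  linear_combination hy

theorem exists_primitive_torsion [IsAlgClosed K] {T : K} (hT : T ≠ 0) {k : ℕ} (hk : 0 < k) :
    ∃ x, (lubinTate F T ^ k) x = 0 ∧ (lubinTate F T ^ (k - 1)) x ≠ 0 := by
  have hq : 1 < Fintype.card F := Fintype.one_lt_card
  obtain ⟨c, hc⟩ := IsAlgClosed.exists_pow_nat_eq (-T) (show 0 < Fintype.card F - 1 by omega)
  have hc0 : c ≠ 0 := by
    rintro rfl
    rw [zero_pow (by omega)] at hc
    exact hT (neg_eq_zero.mp hc.symm)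
  have hcΦ : lubinTate F T c = 0 := by
    rw [lubinTate_apply, show Fintype.card F = Fintype.card F - 1 + 1 by omega, pow_succ, hc]
    ring
  have hsurj : Function.Surjective (lubinTate F T ^ (k - 1)) := by
    rw [Module.End.coe_pow]
    exact (lubinTate_surjective T).iterate _
  obtain ⟨x, hx⟩ := hsurj c
  refine ⟨x, ?_, hx ▸ hc0⟩
  rw [show k = k - 1 + 1 by omega, pow_succ', Module.End.mul_apply, hx, hcΦ]

theorem valuation_lt_one_of_lubinTate_pow_eq_zero {B : ValuationSubring K} {T : K}
    (hT : B.valuation T < 1) {k : ℕ} {x : K} (hx : (lubinTate F T ^ k) x = 0) :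
    B.valuation x < 1 := by
  have hstep : ∀ y, B.valuation (lubinTate F T y) < 1 → B.valuation y < 1 := by
    intro y hy
    by_contra! h
    have h0 : 0 < B.valuation y := zero_lt_one.trans_le h
    have h1 : B.valuation (T * y) < B.valuation y := by
      rw [map_mul]
      exact mul_lt_of_lt_one_left h0 hT
    have h2 : B.valuation y ≤ B.valuation (y ^ Fintype.card F) := by
      rw [map_pow]
      exact le_self_pow₀ h Fintype.card_ne_zero
    rw [lubinTate_apply, Valuation.map_add_eq_of_lt_left _ (h1.trans_le h2)] at hy
    exact absurd hy (not_lt.mpr (h.trans h2))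
  induction k generalizing x with
  | zero =>
    have : x = 0 := by simpa using hx
    simp [this]
  | succ k ih =>
    refine hstep x (ih ?_)
    rwa [pow_succ, Module.End.mul_apply] at hx

variable {B : ValuationSubring K}

theorem coe_eval_iterate_lubinTatePoly (T : B) (l : ℕ) (x : B) :
    ((((lubinTatePoly F T).comp^[l] Polynomial.X).eval x : B) : K) =
      (lubinTate F (T : K) ^ l) x := by
  rw [Polynomial.iterate_comp_eval, Polynomial.eval_X]
  induction l with
  | zero => simp
  | succ l ih =>
    rw [Function.iterate_succ_apply', pow_succ', Module.End.mul_apply, ← ih]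
    simp [lubinTatePoly]

/-- The polynomial over the valuation ring describing the action of `w : F⟦t⟧ / t ^ k`. -/
def actionPoly {k : ℕ} (φ : F →+* B) (T : B) (w : Rk F k) : Polynomial B :=
  ∑ l : Fin k, Polynomial.C (φ (w.toPoly.coeff l)) *
    (lubinTatePoly F T).comp^[(l : ℕ)] Polynomial.X

theorem coe_eval_actionPoly {k : ℕ} {φ : F →+* B} (hφ : ∀ a, (φ a : K) = algebraMap F K a) (T : B)
    (w : Rk F k) (x : B) :
    (((actionPoly φ T w).eval x : B) : K) =
      Polynomial.aeval (lubinTate F (T : K)) w.toPoly x := by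
  have hsum : Polynomial.aeval (lubinTate F (T : K)) w.toPoly =
      ∑ l ∈ Finset.range k, w.toPoly.coeff l • lubinTate F (T : K) ^ l := by
    conv_lhs => rw [w.toPoly_eq_sum]
    simp [Algebra.smul_def]
  rw [hsum, actionPoly, Polynomial.eval_finsetSum, LinearMap.sum_apply, ← Fin.sum_univ_eq_sum_range
    (fun l => (w.toPoly.coeff l • lubinTate F (T : K) ^ l) (x : K))]
  push_cast
  refine Finset.sum_congr rfl fun l _ => ?_
  rw [Polynomial.eval_mul, Polynomial.eval_C, LinearMap.smul_apply, Algebra.smul_def, ← hφ,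
    ← coe_eval_iterate_lubinTatePoly]
  rfl

end LubinTate

theorem exists_valuationSubring_RatFunc (F : Type) [Field F] (K : Type) [Field K]
    [Algebra (RatFunc F) K] [Algebra F K] [IsScalarTower F (RatFunc F) K] :
    ∃ (B : ValuationSubring K) (T : K), T ≠ 0 ∧ B.valuation T < 1 ∧ ∀ a : F, algebraMap F K a ∈ B := by
  set f : Polynomial F →+* K := (algebraMap (RatFunc F) K).comp (algebraMap (Polynomial F) (RatFunc F))
    with hf
  have hinj : Function.Injective f :=
    (algebraMap (RatFunc F) K).injective.comp (RatFunc.algebraMap_injective F)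
  set A : Subring K := f.range
  set X' : A := ⟨f Polynomial.X, ⟨_, rfl⟩⟩ with hX'
  have hI : Ideal.span {X'} ≠ ⊤ := by
    intro h
    rw [Ideal.span_singleton_eq_top, isUnit_iff_exists_inv] at h
    obtain ⟨⟨_, p, rfl⟩, hp⟩ := h
    have h1 : f (Polynomial.X * p) = f 1 := by
      rw [map_mul, map_one]
      exact congrArg Subtype.val hp
    exact Polynomial.not_isUnit_X (IsUnit.of_mul_eq_one _ (hinj h1))
  obtain ⟨B, hAB, hIB⟩ := Ideal.image_subset_nonunits_valuationSubring _ hI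
  refine ⟨B, f Polynomial.X, ?_, ?_, fun a => hAB ⟨Polynomial.C a, ?_⟩⟩
  · rw [Ne, ← map_zero f, hinj.eq_iff]
    exact Polynomial.X_ne_zero
  · exact hIB ⟨X', Ideal.mem_span_singleton_self _, rfl⟩
  · rw [IsScalarTower.algebraMap_apply F (RatFunc F) K]
    simp [hf]

section Curve

variable {F K : Type} [Field F] [Fintype F] [Field K] {B : ValuationSubring K} {k n : ℕ}

open IsLocalRing in
theorem map_residue_actionPoly [Algebra F (ResidueField B)] {φ : F →+* B}
    (hφ : ∀ a, residue B (φ a) = algebraMap F (ResidueField B) a) {T : B}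
    (hT : T ∈ maximalIdeal B) (w : Rk F k) :
    (((actionPoly φ T w).map (residue B) : Polynomial (ResidueField B)) :
      PowerSeries (ResidueField B)) =
        frobeniusSeries (ResidueField B) fun l : Fin k => w.toPoly.coeff l := by
  rw [actionPoly, frobeniusSeries, Polynomial.map_sum, ← Polynomial.coeToPowerSeries.ringHom_apply,
    map_sum]
  refine Finset.sum_congr rfl fun l _ => ?_
  simp [map_iterate_lubinTatePoly F hT, hφ]

open IsLocalRing in
theorem X_pow_dvd_aeval_frobeniusSeries [Algebra F (ResidueField B)] {φ : F →+* B}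
    (hφ : ∀ a, residue B (φ a) = algebraMap F (ResidueField B) a) {T : B}
    (hT : T ∈ maximalIdeal B) {ι : Rk F k → B} (hι : Function.Injective ι)
    (hιmem : ∀ r, ι r ∈ maximalIdeal B) (hadd : ∀ r s, ι (r + s) = ι r + ι s)
    (hmul : ∀ r w, ι (r * w) = (actionPoly φ T w).eval (ι r)) {E : Set (Fin n → Rk F k)}
    {P : MvPolynomial (Fin n) B} (hP : ∀ v ∈ E, MvPolynomial.eval (fun i => ι (v i)) P = 0)
    (b w : Fin n → Rk F k) {m : ℕ} (hm : m ≤ (rline b w ∩ E).ncard) :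
    PowerSeries.X ^ m ∣ MvPolynomial.aeval
      (fun i => frobeniusSeries (ResidueField B) fun l : Fin k => (w i).toPoly.coeff l)
      (P.map (residue B)) := by
  set G : Polynomial B :=
    MvPolynomial.aeval (fun i => Polynomial.C (ι (b i)) + actionPoly φ T (w i)) P with hG
  set S : Finset (Rk F k) := (Set.toFinite {r : Rk F k | (fun i => b i + r * w i) ∈ E}).toFinset
    with hS
  have hcard : m ≤ (S.image ι).card := by
    rw [Finset.card_image_of_injective _ hι]
    refine hm.trans ?_
    rw [← Set.ncard_coe_finset]
    have hsub : rline b w ∩ E ⊆ (fun r i => b i + r * w i) '' (S : Set (Rk F k)) := by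
      rintro _ ⟨⟨r, rfl⟩, hr⟩
      exact ⟨r, by simpa [hS] using hr, rfl⟩
    exact (Set.ncard_le_ncard hsub (S.finite_toSet.image _)).trans
      (Set.ncard_image_le S.finite_toSet)
  have heval : ∀ r ∈ S, G.eval (ι r) = 0 := by
    intro r hr
    have hr' : (fun i => b i + r * w i) ∈ E := by simpa [hS] using hr
    have h := hP _ hr'
    rw [hG, MvPolynomial.aeval_def, ← Polynomial.coe_evalRingHom, MvPolynomial.hom_eval₂]
    rw [← h, MvPolynomial.eval, MvPolynomial.coe_eval₂Hom]
    congr 1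
    · ext; simp
    · funext i
      simp [hadd, hmul]
  have hdvd : ∏ y ∈ S.image ι, (Polynomial.X - Polynomial.C y) ∣ G := by
    by_cases hG0 : G = 0
    · rw [hG0]; exact dvd_zero _
    refine (Multiset.prod_X_sub_C_dvd_iff_le_roots hG0 (S.image ι).val).mpr ?_
    rw [Multiset.le_iff_subset (S.image ι).nodup]
    intro y hy
    obtain ⟨r, hr, rfl⟩ := Finset.mem_image.mp hy
    exact (Polynomial.mem_roots hG0).mpr (heval r hr)
  have hdvd' : Polynomial.X ^ m ∣ G.map (residue B) := by
    refine (pow_dvd_pow _ hcard).trans ?_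
    have h := Polynomial.map_dvd (residue B) hdvd
    rw [Polynomial.map_prod] at h
    rw [← Finset.prod_const]
    refine (dvd_of_eq (Finset.prod_congr rfl fun y hy => ?_)).trans h
    obtain ⟨r, hr, rfl⟩ := Finset.mem_image.mp hy
    simp [(residue_eq_zero_iff _).mpr (hιmem r)]
  have hmap : MvPolynomial.aeval
      (fun i => frobeniusSeries (ResidueField B) fun l : Fin k => (w i).toPoly.coeff l)
      (P.map (residue B)) =
        Polynomial.coeToPowerSeries.ringHom (G.map (residue B)) := by
    rw [hG, MvPolynomial.aeval_def, MvPolynomial.eval₂_map, MvPolynomial.aeval_def,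
      ← Polynomial.coe_mapRingHom, MvPolynomial.hom_eval₂, MvPolynomial.hom_eval₂]
    congr 1
    · ext; simp
    · funext i
      simp only [Polynomial.coe_mapRingHom, Polynomial.map_add,
        Polynomial.map_C, (residue_eq_zero_iff _).mpr (hιmem (b i)), map_zero, zero_add,
        Polynomial.coeToPowerSeries.ringHom_apply, map_residue_actionPoly hφ hT]
  rw [hmap]
  have h := map_dvd Polynomial.coeToPowerSeries.ringHom hdvd'
  rwa [map_pow, Polynomial.coeToPowerSeries.ringHom_apply, Polynomial.coe_X] at h

end Curve

section Interpolation

/-- The exponent vector of a monomial of degree at most `d`, given as a degree `d` homogeneous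
monomial with an additional variable. -/
def symExponent {n d : ℕ} (s : Sym (Fin (n + 1)) d) : Fin n →₀ ℕ :=
  Finsupp.equivFunOnFinite.symm fun i => Multiset.count i.succ (s : Multiset (Fin (n + 1)))

theorem count_zero_add_sum_symExponent {n d : ℕ} (s : Sym (Fin (n + 1)) d) :
    Multiset.count 0 (s : Multiset (Fin (n + 1))) + ∑ i, symExponent s i = d := by
  have h := Multiset.toFinset_sum_count_eq (s : Multiset (Fin (n + 1)))
  rw [Finset.sum_subset (Finset.subset_univ _) (by simp), Fin.sum_univ_succ, Sym.card_coe] at h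
  exact h

theorem symExponent_injective {n d : ℕ} :
    Function.Injective (symExponent : Sym (Fin (n + 1)) d → Fin n →₀ ℕ) := by
  intro s s' h
  have h0 := count_zero_add_sum_symExponent s
  have h0' := count_zero_add_sum_symExponent s'
  rw [h] at h0
  refine Sym.coe_injective (Multiset.ext.mpr fun i => ?_)
  induction i using Fin.cases with
  | zero => exact Nat.add_right_cancel (h0.trans h0'.symm)
  | succ i => exact DFunLike.congr_fun h i

variable {K : Type*} [Field K] (B : ValuationSubring K)

open IsLocalRing in
theorem exists_mvPolynomial_vanishing_map_residue_ne_zero {n d : ℕ} {α : Type*} [Finite α]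
    (x : α → Fin n → B) (hα : Nat.card α < (d + n).choose n) :
    ∃ P : MvPolynomial (Fin n) B, (∀ a, MvPolynomial.eval (x a) P = 0) ∧
      P.map (residue B) ≠ 0 ∧ (P.map (residue B)).totalDegree ≤ d := by
  have := Fintype.ofFinite α
  let L : (Sym (Fin (n + 1)) d → K) →ₗ[K] (α → K) :=
    LinearMap.pi fun a => ∑ s, (∏ i, (x a i : K) ^ symExponent s i) • LinearMap.proj s
  have hker : LinearMap.ker L ≠ ⊥ := by
    apply LinearMap.ker_ne_bot_of_finrank_lt
    rw [Module.finrank_fintype_fun_eq_card, Module.finrank_fintype_fun_eq_card,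
      Sym.card_sym_eq_choose, Fintype.card_fin, ← Nat.card_eq_fintype_card,
      show n + 1 + d - 1 = d + n by omega, Nat.choose_symm_add]
    exact hα
  obtain ⟨c, hc, hc0⟩ := (Submodule.ne_bot_iff _).mp hker
  obtain ⟨s₁, hs₁⟩ := Function.ne_iff.mp hc0
  have : Nonempty (Sym (Fin (n + 1)) d) := ⟨s₁⟩
  obtain ⟨s₀, hs₀⟩ := Finite.exists_max fun s => B.valuation (c s)
  have hcs₀ : c s₀ ≠ 0 := by
    rw [← B.valuation.ne_zero_iff]
    exact ((B.valuation.pos_iff.mpr hs₁).trans_le (hs₀ s₁)).ne'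
  have hmem : ∀ s, c s / c s₀ ∈ B := by
    intro s
    rw [← B.valuation_le_one_iff, map_div₀]
    exact div_le_one_of_le₀ (hs₀ s) zero_le
  let P : MvPolynomial (Fin n) B :=
    ∑ s, MvPolynomial.monomial (symExponent s) (⟨c s / c s₀, hmem s⟩ : B)
  refine ⟨P, fun a => ?_, ?_, ?_⟩
  · have h : ∑ s, (∏ i, (x a i : K) ^ symExponent s i) * c s = 0 := by
      simpa [L] using congrFun (LinearMap.mem_ker.mp hc) a
    apply Subtype.val_injective
    simp only [P, map_sum, MvPolynomial.eval_monomial, Finsupp.prod_fintype, pow_zero, implies_true]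
    push_cast
    rw [← mul_zero (c s₀)⁻¹, ← h, Finset.mul_sum]
    refine Finset.sum_congr rfl fun s _ => ?_
    ring
  · refine MvPolynomial.ne_zero_iff.mpr ⟨symExponent s₀, ?_⟩
    rw [MvPolynomial.coeff_map, MvPolynomial.coeff_sum]
    simp [MvPolynomial.coeff_monomial, symExponent_injective.eq_iff, hcs₀]
    exact isUnit_one
  · refine (Finset.sup_mono (MvPolynomial.support_map_subset _ _)).trans ?_
    refine (MvPolynomial.totalDegree_finsetSum _ _).trans (Finset.sup_le fun s _ => ?_)
    refine (MvPolynomial.totalDegree_monomial_le _ _).trans ?_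
    rw [Finsupp.sum_fintype _ _ fun _ => rfl]
    exact (Nat.le_add_left _ _).trans (count_zero_add_sum_symExponent s).le

end Interpolation

theorem floor_mul_lt {q n k M : ℕ} (hq : 2 ≤ q) (hn : 0 < n) (hk : 0 < k) (hM : M ≤ q ^ k) {c : ℝ}
    (hc0 : 0 < c) (hc1 : c < 1) :
    (⌊c / ((k : ℝ) * n) * (q : ℝ) ^ (k - 1)⌋₊ : ℝ) *
      ((q ^ k + M + k * (q ^ k - q ^ (k - 1)) : ℕ) : ℝ) < c * ((q : ℝ) ^ k * (q : ℝ) ^ k) := by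
  have hq0 : (0 : ℝ) < q := by exact_mod_cast (show 0 < q by omega)
  have hn1 : (1 : ℝ) ≤ n := by exact_mod_cast hn
  have hk1 : (1 : ℝ) ≤ k := by exact_mod_cast hk
  obtain hd | hd := Nat.eq_zero_or_pos ⌊c / ((k : ℝ) * n) * (q : ℝ) ^ (k - 1)⌋₊
  · rw [hd, Nat.cast_zero, zero_mul]
    positivity
  have hk2 : 2 ≤ k := by
    by_contra! h
    obtain rfl : k = 1 := by omega
    rw [gt_iff_lt, Nat.floor_pos] at hd
    have h1 : c / n < 1 := (div_lt_one (by positivity)).mpr (hc1.trans_le hn1)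
    simp only [Nat.cast_one, one_mul, Nat.sub_self, pow_zero, mul_one] at hd
    linarith
  have hD : q ^ k + M + k * (q ^ k - q ^ (k - 1)) < k * q ^ (k + 1) := by
    have h1 : q ^ k - q ^ (k - 1) < q ^ k := Nat.sub_lt (by positivity) (by positivity)
    have h2 := Nat.mul_lt_mul_of_pos_left h1 hk
    have h3 : (k + 2) * q ^ k ≤ k * q * q ^ k := Nat.mul_le_mul_right _ (by nlinarith)
    rw [pow_succ]
    linarith
  have hD' : ((q ^ k + M + k * (q ^ k - q ^ (k - 1)) : ℕ) : ℝ) < k * (q : ℝ) ^ (k + 1) := by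
    exact_mod_cast hD
  have hfloor : (⌊c / ((k : ℝ) * n) * (q : ℝ) ^ (k - 1)⌋₊ : ℝ) ≤
      c / ((k : ℝ) * n) * (q : ℝ) ^ (k - 1) := Nat.floor_le (by positivity)
  calc _ < (⌊c / ((k : ℝ) * n) * (q : ℝ) ^ (k - 1)⌋₊ : ℝ) * (k * (q : ℝ) ^ (k + 1)) :=
        mul_lt_mul_of_pos_left hD' (by exact_mod_cast hd)
    _ ≤ c / ((k : ℝ) * n) * (q : ℝ) ^ (k - 1) * (k * (q : ℝ) ^ (k + 1)) := by gcongr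
    _ = c * ((q : ℝ) ^ k * (q : ℝ) ^ k) / n := by
        obtain ⟨j, rfl⟩ : ∃ j, k = j + 1 := ⟨k - 1, by omega⟩
        rw [Nat.add_sub_cancel]
        field_simp
        ring
    _ ≤ _ := div_le_self (by positivity) hn1

/-- **Discrete Kakeya bound modulo `t^k`.** Every `(ε,ν)`-Kakeya set
`E ⊆ R^n` modulo `t^k` satisfies `|E| ≥ C(⌊(νε/(kn))·q^{k-1}⌋ + n, n)`. -/
theorem kakeya_mod_tk_card_bound
    (Fq : Type) [Field Fq] [Fintype Fq] (n k : ℕ) (hn : 0 < n) (hk : 0 < k)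
    (ε ν : ℝ) (hε : ε ∈ Set.Ioo (0 : ℝ) 1) (hν : ν ∈ Set.Ioo (0 : ℝ) 1)
    (E : Set (Fin n → Rk Fq k)) (Ω : Set (Fin n → Rk Fq k))
    (hΩ : Ω ⊆ primSet Fq n k)
    (hΩcard : ν * (Fintype.card Fq : ℝ) ^ (n * k) ≤ (Ω.ncard : ℝ))
    (hlines : ∀ w ∈ Ω, ∃ b : Fin n → Rk Fq k,
      ε * (Fintype.card Fq : ℝ) ^ k ≤ ((rline b w ∩ E).ncard : ℝ)) :
    (⌊ν * ε / ((k : ℝ) * n) * (Fintype.card Fq : ℝ) ^ (k - 1)⌋₊ + n).choose n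
      ≤ E.ncard := by
  set K := AlgebraicClosure (RatFunc Fq)
  obtain ⟨B, T, hT0, hT1, hFB⟩ := exists_valuationSubring_RatFunc Fq K
  obtain ⟨x, hx, hx'⟩ := exists_primitive_torsion (F := Fq) hT0 hk
  let φ : Fq →+* B := (algebraMap Fq K).codRestrict B hFB
  let TB : B := ⟨T, (B.valuation_le_one_iff T).mp hT1.le⟩
  have hTB : TB ∈ IsLocalRing.maximalIdeal B := (B.valuation_lt_one_iff TB).mpr hT1
  have hval : ∀ r : Rk Fq k, B.valuation (torsionMap (lubinTate Fq T) x r) < 1 := fun r =>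
    valuation_lt_one_of_lubinTate_pow_eq_zero hT1 (pow_torsionMap hx r)
  let ι : Rk Fq k → B := fun r =>
    ⟨torsionMap (lubinTate Fq T) x r, (B.valuation_le_one_iff _).mp (hval r).le⟩
  let _ : Algebra Fq (IsLocalRing.ResidueField B) :=
    ((IsLocalRing.residue B).comp φ).toAlgebra
  by_contra! hE
  set d := ⌊ν * ε / ((k : ℝ) * n) * (Fintype.card Fq : ℝ) ^ (k - 1)⌋₊ with hd
  set q := Fintype.card Fq with hq
  obtain ⟨P, hPE, hP0, hPdeg⟩ := exists_mvPolynomial_vanishing_map_residue_ne_zero B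
    (fun (v : E) i => ι (v.1 i)) (d := d) (by rwa [Nat.card_coe_set_eq])
  set P' := P.map (IsLocalRing.residue B)
  set M := ⌈ε * (q : ℝ) ^ k⌉₊ with hM
  have hqpos : (0 : ℝ) < q := by exact_mod_cast Fintype.card_pos
  have hMle : M ≤ q ^ k := by
    rw [hM, Nat.ceil_le]
    push_cast
    exact mul_le_of_le_one_left (by positivity) hε.2.le
  let ψ : (Fin n → Rk Fq k) → (Fin n → Fin k → Fq) := fun w i l => (w i).toPoly.coeff l
  have hψ : Function.Injective ψ := fun w w' h =>
    funext fun i => Rk.ext_coeff (congrFun (congrFun h i))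
  have htrunc : ∀ w ∈ Ω, truncOrder M (MvPolynomial.aeval
      (fun i => frobeniusSeries (IsLocalRing.ResidueField B) (ψ w i)) P') = M := by
    intro w hw
    obtain ⟨b, hb⟩ := hlines w hw
    refine truncOrder_of_pow_dvd (X_pow_dvd_aeval_frobeniusSeries (φ := φ) (fun _ => rfl) hTB
      (ι := ι) ?_ ?_ ?_ ?_ (E := E) (fun v hv => hPE ⟨v, hv⟩) b w (Nat.ceil_le.mpr hb))
    · exact fun r s h => torsionMap_injective hx hx' (congrArg Subtype.val h)
    · exact fun r => (B.valuation_lt_one_iff (ι r)).mpr (hval r)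
    · exact fun r s => Subtype.ext (torsionMap_add hx r s)
    · intro r w
      apply Subtype.ext
      rw [coe_eval_actionPoly (fun _ => rfl)]
      exact torsionMap_mul hx r w
  have hΩM : Ω.ncard * M ≤ ∑ w : Fin n → Fin k → Fq, truncOrder M (MvPolynomial.aeval
      (fun i => frobeniusSeries (IsLocalRing.ResidueField B) (w i)) P') := by
    have hfin := Ω.toFinite
    rw [Set.ncard_eq_toFinset_card Ω hfin, ← smul_eq_mul, ← Finset.sum_const]
    calc ∑ _w ∈ hfin.toFinset, M
        = ∑ w ∈ hfin.toFinset.image ψ, truncOrder M (MvPolynomial.aeval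
            (fun i => frobeniusSeries (IsLocalRing.ResidueField B) (w i)) P') := by
          rw [Finset.sum_image hψ.injOn]
          exact Finset.sum_congr rfl fun w hw => (htrunc w (hfin.mem_toFinset.mp hw)).symm
      _ ≤ _ := Finset.sum_le_sum_of_subset (Finset.subset_univ _)
  have hmain := (Nat.mul_le_mul_left (q ^ k) hΩM).trans
    (sum_truncOrder_aeval_frobeniusSeries_le M k n P' hP0)
  rw [← hq] at hmain
  replace hmain := hmain.trans (Nat.mul_le_mul_right _ (Nat.mul_le_mul_right _ hPdeg))
  have hmain' : (q : ℝ) ^ k * (Ω.ncard * M) ≤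
      d * ((q ^ k + M + k * (q ^ k - q ^ (k - 1)) : ℕ) : ℝ) * ((q : ℝ) ^ k) ^ n := by
    exact_mod_cast hmain
  have hlt := floor_mul_lt (q := q) Fintype.one_lt_card hn hk hMle (mul_pos hν.1 hε.1)
    (mul_lt_one_of_nonneg_of_lt_one_left hν.1.le hν.2 hε.2.le)
  rw [← hd] at hlt
  have hlow : (q : ℝ) ^ k * (ν * (q : ℝ) ^ (n * k) * (ε * (q : ℝ) ^ k)) ≤
      (q : ℝ) ^ k * (Ω.ncard * M) := by
    have := hε.1
    gcongr
    exact Nat.le_ceil _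
  have hpow : (0 : ℝ) < ((q : ℝ) ^ k) ^ n := by positivity
  have hup := mul_lt_mul_of_pos_right hlt hpow
  rw [mul_comm n k, pow_mul] at hlow
  linarith
end
end
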